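/- arXiv:math/0607124 — 5 statements merged into one kernel-verified Lean document; each statement's English description precedes it below -/
import Mathlib

section
/- Consider the move-to-front scheme on n cards with card probabilities p_1 ≥ p_2 ≥ ⋯ ≥ p_n, where each p_j > 0, ∑_j p_j = 1, and p_j ≤ 1/3 for every j. Let τ_u := min{ t ≥ 0 : ∑_{j=1}^{n−1} (1 − p_j)^t ≤ 1/4 }. Then (1/25) τ_u − 1 ≤ τ_mix ≤ τ_u, where τ_mix is the mixing time of the chain. -/
open Finset

/-- Total variation distance between two distributions on a finite set. -/
noncomputable def tvDist {S : Type*} [Fintype S] (μ ν : S → ℝ) : ℝ :=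
  (1/2) * ∑ s, |μ s - ν s|

/-- Point mass at `s0`. -/
noncomputable def dirac {S : Type*} [DecidableEq S] (s0 : S) : S → ℝ :=
  fun s => if s = s0 then 1 else 0

/-- Distribution of the chain with transition matrix `P` after `t` steps, started from `μ`. -/
noncomputable def evolve {S : Type*} [Fintype S] (P : S → S → ℝ) (μ : S → ℝ) : ℕ → S → ℝ
  | 0 => μ
  | t+1 => fun s' => ∑ s, evolve P μ t s * P s s'

/-- Mixing time: the worst case over starting states of the first time the
total variation distance to `π` drops to `1/4`. -/
noncomputable def mixTime {S : Type*} [Fintype S] [DecidableEq S]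
    (P : S → S → ℝ) (π : S → ℝ) : ℕ :=
  Finset.univ.sup fun s0 => sInf {t : ℕ | tvDist (evolve P (dirac s0) t) π ≤ 1/4}

/-- Transition matrix of the move-to-front scheme on `n` cards with card
probabilities `p`.  A state `σ` records the position `σ c` (with `0` the top) of
each card `c`; moving card `j` to the top turns `σ` into `Fin.cycleRange (σ j) * σ`. -/
noncomputable def mtfP (n : ℕ) (p : Fin n → ℝ) (σ σ' : Equiv.Perm (Fin n)) : ℝ :=
  ∑ j, if Fin.cycleRange (σ j) * σ = σ' then p j else 0

/-- The state obtained from `s` by moving card `j` to the top. -/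
def moveFront {n : ℕ} (j : Fin n) (s : Equiv.Perm (Fin n)) : Equiv.Perm (Fin n) :=
  Fin.cycleRange (s j) * s

theorem moveFront_lt_self {n : ℕ} {j c : Fin n} (s : Equiv.Perm (Fin n)) (h : c ≠ j) :
    moveFront j s j < moveFront j s c := by
  obtain ⟨m, rfl⟩ : ∃ m, n = m + 1 := ⟨n - 1, by have := j.pos; omega⟩
  have h1 : moveFront j s j = 0 := by simp [moveFront]
  rw [h1, Fin.pos_iff_ne_zero, ← h1]
  exact fun e => h ((moveFront j s).injective e)

theorem moveFront_lt_iff {n : ℕ} {j a c : Fin n} (s : Equiv.Perm (Fin n)) (ha : a ≠ j)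
    (hc : c ≠ j) : moveFront j s a < moveFront j s c ↔ s a < s c := by
  have ha' : s a ≠ s j := fun e => ha (s.injective e)
  have hc' : s c ≠ s j := fun e => hc (s.injective e)
  have key : ∀ x : Fin n, x ≠ s j →
      (Fin.cycleRange (s j) x : ℕ) = if x < s j then (x : ℕ) + 1 else x := by
    intro x hx
    split_ifs with hlt
    · exact Fin.coe_cycleRange_of_lt hlt
    · rw [Fin.cycleRange_of_gt (lt_of_le_of_ne (not_lt.1 hlt) hx.symm)]
  have e1 := key _ ha'
  have e2 := key _ hc'
  simp only [moveFront, Equiv.Perm.mul_apply, Fin.lt_def] at *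
  rw [e1, e2]
  have h1 : (s a : ℕ) ≠ s j := fun e => ha' (Fin.ext e)
  have h2 : (s c : ℕ) ≠ s j := fun e => hc' (Fin.ext e)
  split_ifs <;> omega

/-- The transition operator of the move-to-front scheme, acting on functions of the state. -/
def mtfOp {n : ℕ} (p : Fin n → ℝ) (g : Equiv.Perm (Fin n) → ℝ) (s : Equiv.Perm (Fin n)) : ℝ :=
  ∑ j, p j * g (moveFront j s)

theorem sum_mtfP_mul {n : ℕ} (p : Fin n → ℝ) (g : Equiv.Perm (Fin n) → ℝ)
    (s : Equiv.Perm (Fin n)) : ∑ s', mtfP n p s s' * g s' = mtfOp p g s := by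
  simp only [mtfP, mtfOp, Finset.sum_mul]
  rw [Finset.sum_comm]
  refine Finset.sum_congr rfl fun j _ => ?_
  simp [ite_mul, moveFront]

theorem sum_sum_mul_mtfP {n : ℕ} (p : Fin n → ℝ) (μ g : Equiv.Perm (Fin n) → ℝ) :
    ∑ s', (∑ s, μ s * mtfP n p s s') * g s' = ∑ s, μ s * mtfOp p g s := by
  simp only [Finset.sum_mul]
  rw [Finset.sum_comm]
  refine Finset.sum_congr rfl fun s _ => ?_
  rw [← sum_mtfP_mul, Finset.mul_sum]
  exact Finset.sum_congr rfl fun _ _ => by ring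

theorem sum_evolve_mul {n : ℕ} (p : Fin n → ℝ) (μ : Equiv.Perm (Fin n) → ℝ) (t : ℕ)
    (g : Equiv.Perm (Fin n) → ℝ) :
    ∑ s, evolve (mtfP n p) μ t s * g s = ∑ s, μ s * (mtfOp p)^[t] g s := by
  induction t generalizing g with
  | zero => rfl
  | succ t ih =>
    rw [Function.iterate_succ_apply, ← ih]
    exact sum_sum_mul_mtfP p _ g

theorem sum_dirac_mul {S : Type*} [Fintype S] [DecidableEq S] (s0 : S) (g : S → ℝ) :
    ∑ s, dirac s0 s * g s = g s0 := by
  simp [dirac]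

theorem mtfP_nonneg {n : ℕ} {p : Fin n → ℝ} (hp : ∀ j, 0 ≤ p j) (s s' : Equiv.Perm (Fin n)) :
    0 ≤ mtfP n p s s' :=
  Finset.sum_nonneg fun j _ => by split_ifs <;> simp [hp]

theorem evolve_dirac_nonneg {n : ℕ} {p : Fin n → ℝ} (hp : ∀ j, 0 ≤ p j)
    (s0 : Equiv.Perm (Fin n)) (t : ℕ) (s : Equiv.Perm (Fin n)) :
    0 ≤ evolve (mtfP n p) (dirac s0) t s := by
  induction t generalizing s with
  | zero => simp only [evolve, dirac]; split_ifs <;> simp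
  | succ t ih => exact Finset.sum_nonneg fun s' _ => mul_nonneg (ih s') (mtfP_nonneg hp _ _)

/-- The expectation of an eigenfunction decays geometrically. -/
theorem sum_evolve_dirac_mul_of_eigen {n : ℕ} {p : Fin n → ℝ} {g : Equiv.Perm (Fin n) → ℝ}
    {r : ℝ} (hg : ∀ s, mtfOp p g s = r * g s) (s0 : Equiv.Perm (Fin n)) (t : ℕ) :
    ∑ s, evolve (mtfP n p) (dirac s0) t s * g s = r ^ t * g s0 := by
  induction t with
  | zero => simpa [evolve] using sum_dirac_mul s0 g
  | succ t ih =>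
    have h := sum_sum_mul_mtfP p (evolve (mtfP n p) (dirac s0) t) g
    rw [show ∑ s, evolve (mtfP n p) (dirac s0) (t + 1) s * g s = _ from h]
    simp only [hg]
    rw [pow_succ', mul_assoc, ← ih, Finset.mul_sum]
    exact Finset.sum_congr rfl fun _ _ => by ring

theorem sum_stationary_mul_of_eigen {n : ℕ} {p : Fin n → ℝ} {π g : Equiv.Perm (Fin n) → ℝ}
    {r : ℝ} (hstat : ∀ s', ∑ s, π s * mtfP n p s s' = π s')
    (hg : ∀ s, mtfOp p g s = r * g s) (hr : r ≠ 1) : ∑ s, π s * g s = 0 := by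
  have h := sum_sum_mul_mtfP p π g
  simp only [hstat, hg] at h
  have h2 : ∑ s, π s * (r * g s) = r * ∑ s, π s * g s := by
    rw [Finset.mul_sum]; exact Finset.sum_congr rfl fun _ _ => by ring
  rw [h2] at h
  have h3 : (1 - r) * ∑ s, π s * g s = 0 := by linarith
  exact (mul_eq_zero.1 h3).resolve_left (sub_ne_zero.2 hr.symm)

theorem sum_stationary_mul_iterate {n : ℕ} {p : Fin n → ℝ} {π : Equiv.Perm (Fin n) → ℝ}
    (hstat : ∀ s', ∑ s, π s * mtfP n p s s' = π s') (t : ℕ) (g : Equiv.Perm (Fin n) → ℝ) :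
    ∑ s, π s * (mtfOp p)^[t] g s = ∑ s, π s * g s := by
  induction t generalizing g with
  | zero => rfl
  | succ t ih =>
    rw [Function.iterate_succ_apply, ih, ← sum_sum_mul_mtfP]
    simp only [hstat]

/-! ### Upper bound -/

theorem perm_eq_of_lt_iff {n : ℕ} {s s' : Equiv.Perm (Fin n)}
    (h : ∀ a c, s a < s c ↔ s' a < s' c) : s = s' := by
  have hm : StrictMono (s' * s⁻¹ : Equiv.Perm (Fin n)) := by
    intro x y hxy
    have := (h (s⁻¹ x) (s⁻¹ y)).1 (by simpa using hxy)
    simpa using this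
  have h1 : (s' * s⁻¹ : Equiv.Perm (Fin n)) = 1 := by
    have := Subsingleton.elim (hm.orderIsoOfSurjective _ (Equiv.surjective _)) (OrderIso.refl (Fin n))
    ext x
    have h2 := congrArg (fun e : Fin n ≃o Fin n => e x) this
    simpa using congrArg Fin.val h2
  exact (mul_inv_eq_one.1 h1).symm

/-- If the decks `s` and `s'` agree on all comparisons involving a card of `A`, then the
simultaneous evolution of both merges them once all cards of `B` have been touched. -/
theorem iterate_sub_le {n : ℕ} {p : Fin n → ℝ} (hp : ∀ j, 0 ≤ p j) (hsum : ∑ j, p j = 1)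
    {B : Finset (Fin n)} (hB : ∀ a c, a ∉ B → c ∉ B → a = c)
    {g : Equiv.Perm (Fin n) → ℝ} (hg : ∀ s s', g s - g s' ≤ 2) (t : ℕ) :
    ∀ (A : Finset (Fin n)) (s s' : Equiv.Perm (Fin n)),
      (∀ a ∈ A, ∀ c, s a < s c ↔ s' a < s' c) →
      (mtfOp p)^[t] g s - (mtfOp p)^[t] g s' ≤ 2 * ∑ j ∈ B \ A, (1 - p j) ^ t := by
  induction t with
  | zero =>
    intro A s s' h
    rcases (B \ A).eq_empty_or_nonempty with he | hne
    · have hss : s = s' := by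
        refine perm_eq_of_lt_iff fun a c => ?_
        have hBA := Finset.sdiff_eq_empty_iff_subset.1 he
        by_cases ha : a ∈ A
        · exact h a ha c
        by_cases hc : c ∈ A
        · rcases eq_or_ne a c with rfl | hac
          · simp
          have h1 := h c hc a
          have n1 : s a ≠ s c := s.injective.ne hac
          have n2 : s' a ≠ s' c := s'.injective.ne hac
          constructor
          · intro hlt
            exact lt_of_le_of_ne (not_lt.1 fun h2 => lt_asymm hlt (h1.2 h2)) n2
          · intro hlt
            exact lt_of_le_of_ne (not_lt.1 fun h2 => lt_asymm hlt (h1.1 h2)) n1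
        · rw [hB a c (fun h' => ha (hBA h')) (fun h' => hc (hBA h'))]
          simp
      simp [hss, he]
    · have h1 : (1 : ℝ) ≤ (B \ A).card := by exact_mod_cast hne.card_pos
      simpa using (hg s s').trans (by linarith)
  | succ t ih =>
    intro A s s' h
    rw [Function.iterate_succ_apply', mtfOp, mtfOp, ← Finset.sum_sub_distrib]
    have step : ∀ k, p k * (mtfOp p)^[t] g (moveFront k s) -
        p k * (mtfOp p)^[t] g (moveFront k s') ≤
        p k * (2 * ∑ j ∈ B \ A, if j = k then 0 else (1 - p j) ^ t) := by
      intro k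
      rw [← mul_sub]
      refine mul_le_mul_of_nonneg_left ?_ (hp k)
      refine (ih (insert k A) _ _ ?_).trans_eq ?_
      · intro a ha c
        rcases eq_or_ne a c with rfl | hac
        · simp
        rcases eq_or_ne a k with rfl | hak
        · exact iff_of_true (moveFront_lt_self s hac.symm) (moveFront_lt_self s' hac.symm)
        rcases eq_or_ne c k with rfl | hck
        · exact iff_of_false (moveFront_lt_self s hak).not_gt (moveFront_lt_self s' hak).not_gt
        rw [moveFront_lt_iff _ hak hck, moveFront_lt_iff _ hak hck]
        exact h a (Finset.mem_of_mem_insert_of_ne ha hak) c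
      · congr 1
        rw [← Finset.sum_filter_add_sum_filter_not (B \ A) (fun j => j = k)]
        have e1 : ∑ j ∈ (B \ A) with j = k, (if j = k then 0 else (1 - p j) ^ t) = 0 :=
          Finset.sum_eq_zero fun j hj => by simp [(Finset.mem_filter.1 hj).2]
        rw [e1, zero_add]
        refine Finset.sum_congr ?_ fun j hj => ?_
        · ext j; simp only [Finset.mem_sdiff, Finset.mem_insert, Finset.mem_filter]; tauto
        · simp [(Finset.mem_filter.1 hj).2]
    refine (Finset.sum_le_sum fun k _ => step k).trans_eq ?_
    have e : ∀ j, ∑ k, p k * (if j = k then 0 else (1 - p j) ^ t) = (1 - p j) ^ (t + 1) := by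
      intro j
      have : ∀ k, p k * (if j = k then 0 else (1 - p j) ^ t) =
          p k * (1 - p j) ^ t - if j = k then p k * (1 - p j) ^ t else 0 := by
        intro k; split_ifs <;> simp
      simp only [this, Finset.sum_sub_distrib, ← Finset.sum_mul, hsum]
      simp
      ring
    simp only [← e]
    rw [Finset.sum_comm, Finset.mul_sum]
    refine Finset.sum_congr rfl fun k _ => ?_
    rw [← Finset.mul_sum]
    ring

theorem tvDist_evolve_le {n : ℕ} {p : Fin n → ℝ} (hp : ∀ j, 0 ≤ p j) (hsum : ∑ j, p j = 1)
    {π : Equiv.Perm (Fin n) → ℝ} (hπ0 : ∀ s, 0 ≤ π s) (hπ1 : ∑ s, π s = 1)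
    (hstat : ∀ s', ∑ s, π s * mtfP n p s s' = π s')
    {B : Finset (Fin n)} (hB : ∀ a c, a ∉ B → c ∉ B → a = c)
    (s0 : Equiv.Perm (Fin n)) (t : ℕ) :
    tvDist (evolve (mtfP n p) (dirac s0) t) π ≤ ∑ j ∈ B, (1 - p j) ^ t := by
  set μ := evolve (mtfP n p) (dirac s0) t with hμ
  let g : Equiv.Perm (Fin n) → ℝ := fun s => if 0 ≤ μ s - π s then 1 else -1
  have hg : ∀ s s', g s - g s' ≤ 2 := by
    intro s s'; simp only [g]; split_ifs <;> norm_num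
  have habs : ∑ s, |μ s - π s| = ∑ s, μ s * g s - ∑ s, π s * g s := by
    rw [← Finset.sum_sub_distrib]
    refine Finset.sum_congr rfl fun s _ => ?_
    simp only [g]
    split_ifs with h
    · rw [abs_of_nonneg h]; ring
    · rw [abs_of_neg (not_le.1 h)]; ring
  have h1 : ∑ s, μ s * g s - ∑ s, π s * g s =
      ∑ s, π s * ((mtfOp p)^[t] g s0 - (mtfOp p)^[t] g s) := by
    simp only [mul_sub, Finset.sum_sub_distrib, ← Finset.sum_mul, hπ1]
    rw [sum_stationary_mul_iterate hstat, hμ, sum_evolve_mul, sum_dirac_mul, one_mul]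
  have h2 : ∑ s, π s * ((mtfOp p)^[t] g s0 - (mtfOp p)^[t] g s) ≤
      ∑ s, π s * (2 * ∑ j ∈ B, (1 - p j) ^ t) := by
    refine Finset.sum_le_sum fun s _ => mul_le_mul_of_nonneg_left ?_ (hπ0 s)
    simpa using iterate_sub_le hp hsum hB hg t ∅ s0 s (by simp)
  rw [← Finset.sum_mul, hπ1, one_mul] at h2
  rw [tvDist, habs, h1]
  linarith

/-! ### Lower bound -/

/-- The centered indicator that card `b` lies above card `a`. -/
noncomputable def pairFun {n : ℕ} (p : Fin n → ℝ) (a b : Fin n) (s : Equiv.Perm (Fin n)) : ℝ :=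
  if s b < s a then p a / (p a + p b) else -(p b / (p a + p b))

/-- The change of `pairFun p a b` when card `j` is moved to the top. -/
noncomputable def pairDiff {n : ℕ} (p : Fin n → ℝ) (a b : Fin n) (s : Equiv.Perm (Fin n))
    (j : Fin n) : ℝ :=
  (if j = a then -(p b / (p a + p b)) - pairFun p a b s else 0) +
    if j = b then p a / (p a + p b) - pairFun p a b s else 0

theorem pairFun_moveFront {n : ℕ} (p : Fin n → ℝ) {a b : Fin n} (hab : a ≠ b)
    (s : Equiv.Perm (Fin n)) (j : Fin n) :
    pairFun p a b (moveFront j s) = pairFun p a b s + pairDiff p a b s j := by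
  rw [pairDiff]
  rcases eq_or_ne j a with rfl | ha
  · have := (moveFront_lt_self s hab.symm).not_gt
    rw [if_pos rfl, if_neg hab, pairFun, if_neg this]
    ring
  rcases eq_or_ne j b with rfl | hb
  · rw [if_pos rfl, if_neg ha, pairFun, if_pos (moveFront_lt_self s hab)]
    ring
  rw [if_neg ha, if_neg hb, pairFun, pairFun]
  simp only [moveFront_lt_iff s hb.symm ha.symm]
  ring

theorem sum_mul_pairDiff {n : ℕ} {p : Fin n → ℝ} {a b : Fin n} (h : p a + p b ≠ 0)
    (s : Equiv.Perm (Fin n)) :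
    ∑ j, p j * pairDiff p a b s j = -(p a + p b) * pairFun p a b s := by
  simp only [pairDiff, mul_add, Finset.sum_add_distrib, mul_ite, mul_zero, Finset.sum_ite_eq',
    Finset.mem_univ, if_true]
  field_simp
  ring

theorem mtfOp_pairFun {n : ℕ} {p : Fin n → ℝ} (hsum : ∑ j, p j = 1) {a b : Fin n} (hab : a ≠ b)
    (h : p a + p b ≠ 0) (s : Equiv.Perm (Fin n)) :
    mtfOp p (pairFun p a b) s = (1 - p a - p b) * pairFun p a b s := by
  simp only [mtfOp, pairFun_moveFront p hab, mul_add, Finset.sum_add_distrib, ← Finset.sum_mul,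
    hsum, sum_mul_pairDiff h]
  ring

theorem mtfOp_pairFun_mul_pairFun {n : ℕ} {p : Fin n → ℝ} (hsum : ∑ j, p j = 1)
    {a b c d : Fin n} (hab : a ≠ b) (hcd : c ≠ d) (hac : a ≠ c) (had : a ≠ d) (hbc : b ≠ c)
    (hbd : b ≠ d) (h : p a + p b ≠ 0) (h' : p c + p d ≠ 0) (s : Equiv.Perm (Fin n)) :
    mtfOp p (fun s => pairFun p a b s * pairFun p c d s) s =
      (1 - p a - p b - p c - p d) * (pairFun p a b s * pairFun p c d s) := by
  have hz : ∀ j, pairDiff p a b s j * pairDiff p c d s j = 0 := by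
    intro j
    rw [mul_eq_zero]
    by_cases hj : j = c ∨ j = d
    · left
      have h1 : j ≠ a := by rintro rfl; tauto
      have h2 : j ≠ b := by rintro rfl; tauto
      simp [pairDiff, h1, h2]
    · right
      push Not at hj
      simp [pairDiff, hj.1, hj.2]
  have hx : ∀ j, p j * (pairFun p a b (moveFront j s) * pairFun p c d (moveFront j s)) =
      p j * (pairFun p a b s * pairFun p c d s) + p j * pairDiff p a b s j * pairFun p c d s +
        p j * pairDiff p c d s j * pairFun p a b s := by
    intro j
    rw [pairFun_moveFront p hab, pairFun_moveFront p hcd]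
    linear_combination p j * hz j
  simp only [mtfOp, hx, Finset.sum_add_distrib, ← Finset.sum_mul, hsum, sum_mul_pairDiff h,
    sum_mul_pairDiff h']
  ring

theorem pairFun_sq_le_one {n : ℕ} {p : Fin n → ℝ} (hp : ∀ j, 0 < p j) (a b : Fin n)
    (s : Equiv.Perm (Fin n)) : pairFun p a b s * pairFun p a b s ≤ 1 := by
  have ha := hp a
  have hb := hp b
  have h1 : p a / (p a + p b) ≤ 1 := (div_le_one (by positivity)).2 (by linarith)
  have h2 : p b / (p a + p b) ≤ 1 := (div_le_one (by positivity)).2 (by linarith)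
  have h3 : 0 ≤ p a / (p a + p b) := by positivity
  have h4 : 0 ≤ p b / (p a + p b) := by positivity
  rw [pairFun]
  split_ifs <;> nlinarith

theorem half_le_div_add {x y : ℝ} (hy : 0 < y) (hyx : y ≤ x) : 1 / 2 ≤ x / (x + y) := by
  rw [div_le_div_iff₀ (by norm_num) (by linarith)]
  linarith

theorem sum_evolve_dirac {n : ℕ} {p : Fin n → ℝ} (hsum : ∑ j, p j = 1)
    (s0 : Equiv.Perm (Fin n)) (t : ℕ) : ∑ s, evolve (mtfP n p) (dirac s0) t s = 1 := by
  have := sum_evolve_dirac_mul_of_eigen (p := p) (g := fun _ => 1) (r := 1)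
    (fun s => by simp [mtfOp, hsum]) s0 t
  simpa using this

/-- Distinguishing statistic given by the relative order of a single pair. -/
theorem pow_le_half_of_tvDist_le {n : ℕ} {p : Fin n → ℝ} (hp : ∀ j, 0 < p j)
    (hsum : ∑ j, p j = 1) {π : Equiv.Perm (Fin n) → ℝ} (hπ1 : ∑ s, π s = 1)
    (hstat : ∀ s', ∑ s, π s * mtfP n p s s' = π s') {s0 : Equiv.Perm (Fin n)} {t : ℕ}
    (htv : tvDist (evolve (mtfP n p) (dirac s0) t) π ≤ 1 / 4) {a b : Fin n} (hab : a ≠ b)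
    (hle : p b ≤ p a) (hs0 : s0 b < s0 a) (hnn : 0 ≤ 1 - p a - p b) :
    (1 - p a - p b) ^ t ≤ 1 / 2 := by
  have hP : 0 < p a + p b := add_pos (hp a) (hp b)
  have heig := mtfOp_pairFun hsum hab hP.ne'
  set μ := evolve (mtfP n p) (dirac s0) t with hμ
  have h1 : ∑ s, μ s * pairFun p a b s = (1 - p a - p b) ^ t * pairFun p a b s0 :=
    sum_evolve_dirac_mul_of_eigen heig s0 t
  have h2 : ∑ s, π s * pairFun p a b s = 0 :=
    sum_stationary_mul_of_eigen hstat heig (by linarith)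
  have hμ1 : ∑ s, μ s = 1 := sum_evolve_dirac hsum s0 t
  have h3 : pairFun p a b s0 = p a / (p a + p b) := if_pos hs0
  set c := p a / (p a + p b) - 1 / 2 with hc
  have h4 : ∑ s, (μ s - π s) * (pairFun p a b s - c) = (1 - p a - p b) ^ t * pairFun p a b s0 := by
    simp only [sub_mul, mul_sub, Finset.sum_sub_distrib, ← Finset.sum_mul, hμ1, hπ1, h1, h2]
    ring
  have h5 : ∑ s, (μ s - π s) * (pairFun p a b s - c) ≤ ∑ s, |μ s - π s| * (1 / 2) := by
    refine Finset.sum_le_sum fun s _ => ?_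
    refine (le_abs_self _).trans ?_
    rw [abs_mul]
    refine mul_le_mul_of_nonneg_left ?_ (abs_nonneg _)
    have hq : p b / (p a + p b) = 1 - p a / (p a + p b) := by field_simp; ring
    rw [pairFun, hc, hq, abs_le]
    split_ifs <;> constructor <;> linarith
  rw [h4, h3, ← Finset.sum_mul] at h5
  rw [tvDist] at htv
  have h6 := mul_le_mul_of_nonneg_left (half_le_div_add (hp b) hle) (pow_nonneg hnn t)
  linarith

/-- Second moment bound for the weighted number of pairs still in their initial order. -/
theorem sum_sq_le_of_tvDist_le {n : ℕ} {p : Fin n → ℝ} (hp : ∀ j, 0 < p j)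
    (hsum : ∑ j, p j = 1) {π : Equiv.Perm (Fin n) → ℝ} (hπ0 : ∀ s, 0 ≤ π s)
    (hπ1 : ∑ s, π s = 1)
    (hstat : ∀ s', ∑ s, π s * mtfP n p s s' = π s') {s0 : Equiv.Perm (Fin n)} {t : ℕ}
    (htv : tvDist (evolve (mtfP n p) (dirac s0) t) π ≤ 1 / 4)
    {ι : Type*} [Fintype ι] {a b : ι → Fin n} (ha : Function.Injective a)
    (hb : Function.Injective b) (hab : ∀ i k, a i ≠ b k)
    (hle : ∀ i, p (b i) ≤ p (a i)) (hs0 : ∀ i, s0 (b i) < s0 (a i))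
    (hnn : ∀ i, 0 ≤ 1 - p (a i) - p (b i)) :
    ∑ i, ((1 - p (a i) - p (b i)) ^ t) ^ 2 ≤ 8 := by
  classical
  have hP : ∀ i, 0 < p (a i) + p (b i) := fun i => add_pos (hp _) (hp _)
  set μ := evolve (mtfP n p) (dirac s0) t with hμ
  have hμ0 : ∀ s, 0 ≤ μ s := evolve_dirac_nonneg (fun j => (hp j).le) s0 t
  have hμ1 : ∑ s, μ s = 1 := sum_evolve_dirac hsum s0 t
  set f : ι → Equiv.Perm (Fin n) → ℝ := fun i => pairFun p (a i) (b i) with hf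
  set y : ι → ℝ := fun i => (1 - p (a i) - p (b i)) ^ t with hy
  have hy0 : ∀ i, 0 ≤ y i := fun i => pow_nonneg (hnn i) t
  have hf0 : ∀ i, 1 / 2 ≤ f i s0 := by
    intro i
    simp only [hf, pairFun, if_pos (hs0 i)]
    exact half_le_div_add (hp _) (hle i)
  have heig : ∀ i, ∀ s, mtfOp p (f i) s = (1 - p (a i) - p (b i)) * f i s :=
    fun i => mtfOp_pairFun hsum (hab i i) (hP i).ne'
  have hfμ : ∀ i, ∑ s, μ s * f i s = y i * f i s0 :=
    fun i => sum_evolve_dirac_mul_of_eigen (heig i) s0 t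
  have hfπ : ∀ i, ∑ s, π s * f i s = 0 :=
    fun i => sum_stationary_mul_of_eigen hstat (heig i) (by have := hP i; linarith)
  have hdiag : ∀ ν : Equiv.Perm (Fin n) → ℝ, (∀ s, 0 ≤ ν s) → ∑ s, ν s = 1 → ∀ i,
      ∑ s, ν s * (f i s * f i s) ≤ 1 := by
    intro ν h0 h1 i
    rw [← h1]
    exact Finset.sum_le_sum fun s _ => mul_le_of_le_one_right (h0 s) (pairFun_sq_le_one hp _ _ s)
  have heig2 : ∀ i k, i ≠ k → ∀ s, mtfOp p (fun s => f i s * f k s) s =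
      (1 - p (a i) - p (b i) - p (a k) - p (b k)) * (f i s * f k s) :=
    fun i k hik => mtfOp_pairFun_mul_pairFun hsum (hab i i) (hab k k) (ha.ne hik) (hab i k)
      (hab k i).symm (hb.ne hik) (hP i).ne' (hP k).ne'
  have hffμ : ∀ i k, ∑ s, μ s * (f i s * f k s) ≤
      (y i * f i s0) * (y k * f k s0) + if i = k then 1 else 0 := by
    intro i k
    rcases eq_or_ne i k with rfl | hik
    · rw [if_pos rfl]
      have := hdiag μ hμ0 hμ1 i
      nlinarith [mul_self_nonneg (y i * f i s0)]
    · rw [if_neg hik, add_zero, hμ, sum_evolve_dirac_mul_of_eigen (heig2 i k hik) s0 t]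
      have h4 : p (a i) + p (b i) + p (a k) + p (b k) ≤ 1 := by
        have hsub : ∑ j ∈ ({a i, b i, a k, b k} : Finset (Fin n)), p j ≤ ∑ j, p j :=
          Finset.sum_le_sum_of_subset_of_nonneg (Finset.subset_univ _) fun j _ _ => (hp j).le
        rw [Finset.sum_insert, Finset.sum_insert, Finset.sum_insert, Finset.sum_singleton,
          hsum] at hsub
        · linarith
        · simpa using hab k k
        · simpa using ⟨(hab k i).symm, hb.ne hik⟩
        · simpa using ⟨hab i i, ha.ne hik, hab i k⟩
      have h5 : (1 - p (a i) - p (b i) - p (a k) - p (b k)) ^ t ≤ y i * y k := by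
        simp only [hy, ← mul_pow]
        refine pow_le_pow_left₀ (by linarith) ?_ t
        nlinarith [mul_pos (hP i) (hP k)]
      calc _ ≤ y i * y k * (f i s0 * f k s0) := by
            refine mul_le_mul_of_nonneg_right h5 (mul_nonneg ?_ ?_)
            · linarith [hf0 i]
            · linarith [hf0 k]
        _ = _ := by ring
  have hffπ : ∀ i k, ∑ s, π s * (f i s * f k s) ≤ if i = k then 1 else 0 := by
    intro i k
    rcases eq_or_ne i k with rfl | hik
    · rw [if_pos rfl]; exact hdiag π hπ0 hπ1 i
    · rw [if_neg hik]
      refine (sum_stationary_mul_of_eigen hstat (heig2 i k hik) ?_).le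
      have := hP i
      have := hP k
      linarith
  set F : Equiv.Perm (Fin n) → ℝ := fun s => ∑ i, y i * f i s with hF
  set S : ℝ := ∑ i, y i ^ 2 with hS
  set d : ℝ := ∑ i, y i * (y i * f i s0) with hd
  have hsq : ∀ ν : Equiv.Perm (Fin n) → ℝ, ∑ s, ν s * F s ^ 2 =
      ∑ i, ∑ k, y i * y k * ∑ s, ν s * (f i s * f k s) := by
    intro ν
    have hs : ∀ s, ν s * F s ^ 2 = ∑ i, ∑ k, y i * y k * (ν s * (f i s * f k s)) := by
      intro s
      rw [hF, sq, Finset.sum_mul_sum, Finset.mul_sum]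
      refine Finset.sum_congr rfl fun i _ => ?_
      rw [Finset.mul_sum]
      exact Finset.sum_congr rfl fun k _ => by ring
    simp only [hs, Finset.mul_sum]
    rw [Finset.sum_comm]
    exact Finset.sum_congr rfl fun i _ => Finset.sum_comm
  have hdelta : ∑ i, ∑ k, y i * y k * (if i = k then (1 : ℝ) else 0) = S := by
    simp [hS, sq]
  have hFμ2 : ∑ s, μ s * F s ^ 2 ≤ d ^ 2 + S := by
    rw [hsq, ← hdelta, hd, sq, Finset.sum_mul_sum, ← Finset.sum_add_distrib]
    refine Finset.sum_le_sum fun i _ => ?_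
    rw [← Finset.sum_add_distrib]
    refine Finset.sum_le_sum fun k _ => ?_
    refine (mul_le_mul_of_nonneg_left (hffμ i k) (mul_nonneg (hy0 i) (hy0 k))).trans_eq ?_
    ring
  have hFπ2 : ∑ s, π s * F s ^ 2 ≤ S := by
    rw [hsq, ← hdelta]
    refine Finset.sum_le_sum fun i _ => Finset.sum_le_sum fun k _ => ?_
    exact mul_le_mul_of_nonneg_left (hffπ i k) (mul_nonneg (hy0 i) (hy0 k))
  have hlin : ∀ ν : Equiv.Perm (Fin n) → ℝ, ∑ s, ν s * F s = ∑ i, y i * ∑ s, ν s * f i s := by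
    intro ν
    simp only [hF, Finset.mul_sum]
    rw [Finset.sum_comm]
    exact Finset.sum_congr rfl fun k _ => Finset.sum_congr rfl fun s _ => by ring
  have hdiff : ∑ s, (μ s - π s) * F s = d := by
    simp only [sub_mul, Finset.sum_sub_distrib, hlin, hfμ, hfπ]
    simp [hd]
  have hCS : (∑ s, (μ s - π s) * F s) ^ 2 ≤
      (∑ s, |μ s - π s|) * ∑ s, |μ s - π s| * F s ^ 2 := by
    refine Finset.sum_sq_le_sum_mul_sum_of_sq_le_mul _ (fun s _ => abs_nonneg _)
      (fun s _ => by positivity) fun s _ => le_of_eq ?_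
    rw [mul_pow, ← sq_abs (μ s - π s)]
    ring
  have hsum2 : ∑ s, |μ s - π s| * F s ^ 2 ≤ d ^ 2 + 2 * S := by
    have : ∑ s, |μ s - π s| * F s ^ 2 ≤ ∑ s, μ s * F s ^ 2 + ∑ s, π s * F s ^ 2 := by
      rw [← Finset.sum_add_distrib]
      refine Finset.sum_le_sum fun s _ => ?_
      rw [← add_mul]
      refine mul_le_mul_of_nonneg_right ?_ (sq_nonneg _)
      rw [abs_le]
      constructor <;> linarith [hμ0 s, hπ0 s]
    linarith
  have hTV : ∑ s, |μ s - π s| ≤ 1 / 2 := by rw [tvDist] at htv; linarith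
  have hS0 : 0 ≤ S := Finset.sum_nonneg fun i _ => sq_nonneg _
  have hdS : S / 2 ≤ d := by
    rw [hS, hd, Finset.sum_div]
    refine Finset.sum_le_sum fun i _ => ?_
    nlinarith [mul_le_mul_of_nonneg_left (hf0 i) (sq_nonneg (y i))]
  have hfin : d ^ 2 ≤ 1 / 2 * (d ^ 2 + 2 * S) := by
    rw [hdiff] at hCS
    exact hCS.trans (mul_le_mul hTV hsum2 (Finset.sum_nonneg fun s _ => by positivity)
      (by norm_num))
  by_contra hcon
  push Not at hcon
  nlinarith

/-- Every card but the last is dominated by a pair of adjacent cards, and each pair is used at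
most twice. -/
theorem sum_pow_le_of_tvDist_le {n : ℕ} {p : Fin n → ℝ} (hp : ∀ j, 0 < p j)
    (hsum : ∑ j, p j = 1) (hmono : ∀ i j : Fin n, i ≤ j → p j ≤ p i) (hthird : ∀ j, p j ≤ 1 / 3)
    {π : Equiv.Perm (Fin n) → ℝ} (hπ0 : ∀ s, 0 ≤ π s) (hπ1 : ∑ s, π s = 1)
    (hstat : ∀ s', ∑ s, π s * mtfP n p s s' = π s') {t : ℕ}
    (htv : tvDist (evolve (mtfP n p) (dirac Fin.revPerm) t) π ≤ 1 / 4) :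
    ∑ j ∈ Finset.univ.filter (fun j : Fin n => (j : ℕ) < n - 1), (1 - p j) ^ (25 * (t + 1)) ≤
      1 / 4 := by
  classical
  let a : Fin (n / 2) → Fin n := fun i => ⟨n - 2 - 2 * i, by have := i.2; omega⟩
  let b : Fin (n / 2) → Fin n := fun i => ⟨n - 1 - 2 * i, by have := i.2; omega⟩
  have hlt : ∀ i, a i < b i := fun i => by
    have := i.2; simp only [a, b, Fin.lt_def]; omega
  have ha : Function.Injective a := fun i k h => by
    have := i.2; have := k.2; simp only [a, Fin.ext_iff] at h ⊢; omega
  have hb : Function.Injective b := fun i k h => by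
    have := i.2; have := k.2; simp only [b, Fin.ext_iff] at h ⊢; omega
  have hab : ∀ i k, a i ≠ b k := fun i k h => by
    have := i.2; have := k.2; simp only [a, b, Fin.ext_iff] at h; omega
  have hle : ∀ i, p (b i) ≤ p (a i) := fun i => hmono _ _ (hlt i).le
  have hs0 : ∀ i, Fin.revPerm (b i) < Fin.revPerm (a i) := fun i => by
    simpa using hlt i
  have hnn : ∀ i, 0 ≤ 1 - p (a i) - p (b i) := fun i => by
    linarith [hthird (a i), hthird (b i)]
  set y : Fin (n / 2) → ℝ := fun i => (1 - p (a i) - p (b i)) ^ t with hy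
  have hy0 : ∀ i, 0 ≤ y i := fun i => pow_nonneg (hnn i) t
  have hyh : ∀ i, y i ≤ 1 / 2 := fun i =>
    pow_le_half_of_tvDist_le hp hsum hπ1 hstat htv (hab i i) (hle i) (hs0 i) (hnn i)
  have hyS : ∑ i, y i ^ 2 ≤ 8 :=
    sum_sq_le_of_tvDist_le hp hsum hπ0 hπ1 hstat htv ha hb hab hle hs0 hnn
  have hy8 : ∀ i, y i ^ 8 ≤ y i ^ 2 / 64 := fun i => by
    have h1 : y i ^ 6 ≤ (1 / 2) ^ 6 := pow_le_pow_left₀ (hy0 i) (hyh i) 6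
    nlinarith [mul_le_mul_of_nonneg_left h1 (sq_nonneg (y i))]
  set J := Finset.univ.filter (fun j : Fin n => (j : ℕ) < n - 1) with hJ
  let φ : Fin n → ℕ := fun j => (n - 2 - j) / 2
  have hterm : ∀ j ∈ J, (1 - p j) ^ (25 * (t + 1)) ≤
      ∑ i : Fin (n / 2), if φ j = i then y i ^ 8 else 0 := by
    intro j hj
    have hj' : (j : ℕ) < n - 1 := (Finset.mem_filter.1 hj).2
    let i : Fin (n / 2) := ⟨φ j, by simp only [φ]; omega⟩
    have hsumi : (∑ k : Fin (n / 2), if φ j = k then y k ^ 8 else 0) = y i ^ 8 := by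
      rw [Finset.sum_eq_single i]
      · simp [i]
      · intro k _ hk
        exact if_neg fun e => hk (Fin.ext e.symm)
      · simp
    rw [hsumi]
    have hpa : p (a i) ≤ p j := hmono _ _ (by simp only [a, i, φ, Fin.le_def]; omega)
    have h0 : 0 ≤ 1 - p j := by linarith [hthird j]
    have h3 : (1 - p j) ^ 3 ≤ 1 - p (a i) - p (b i) := by
      have h1 : (1 - p j) ^ 3 ≤ (1 - p (a i)) ^ 3 := pow_le_pow_left₀ h0 (by linarith) 3
      have h2 := hle i
      have h4 := hp (a i)
      have h5 := hthird (a i)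
      have h6 : 0 ≤ p (a i) * (1 - 3 * p (a i)) := mul_nonneg h4.le (by linarith)
      nlinarith [pow_pos h4 3]
    calc (1 - p j) ^ (25 * (t + 1)) ≤ (1 - p j) ^ (3 * (t * 8)) :=
          pow_le_pow_of_le_one h0 (by linarith [hp j]) (by omega)
      _ = ((1 - p j) ^ 3) ^ (t * 8) := by rw [pow_mul]
      _ ≤ (1 - p (a i) - p (b i)) ^ (t * 8) := pow_le_pow_left₀ (pow_nonneg h0 3) h3 _
      _ = y i ^ 8 := by rw [pow_mul]
  have hcard : ∀ i : Fin (n / 2), (J.filter (fun j => φ j = i)).card ≤ 2 := by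
    intro i
    have : (J.filter (fun j => φ j = i)).card ≤
        ({n - 2 - 2 * (i : ℕ), n - 3 - 2 * (i : ℕ)} : Finset ℕ).card := by
      refine Finset.card_le_card_of_injOn (fun j => (j : ℕ)) ?_ (Fin.val_injective.injOn)
      intro j hj
      simp only [hJ, φ, Finset.coe_filter, Finset.mem_filter, Finset.mem_univ, true_and,
        Set.mem_ofPred_eq] at hj
      simp only [Finset.coe_insert, Finset.coe_singleton, Set.mem_insert_iff,
        Set.mem_singleton_iff]
      omega
    exact this.trans Finset.card_le_two
  calc ∑ j ∈ J, (1 - p j) ^ (25 * (t + 1))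
      ≤ ∑ j ∈ J, ∑ i : Fin (n / 2), if φ j = i then y i ^ 8 else 0 := Finset.sum_le_sum hterm
    _ = ∑ i : Fin (n / 2), ((J.filter (fun j => φ j = i)).card : ℝ) * y i ^ 8 := by
        rw [Finset.sum_comm]
        refine Finset.sum_congr rfl fun i _ => ?_
        rw [← Finset.sum_filter, Finset.sum_const, nsmul_eq_mul]
    _ ≤ ∑ i : Fin (n / 2), 2 * (y i ^ 2 / 64) := by
        refine Finset.sum_le_sum fun i _ => ?_
        exact mul_le_mul (by exact_mod_cast hcard i) (hy8 i) (pow_nonneg (hy0 i) 8) (by norm_num)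
    _ = (∑ i, y i ^ 2) / 32 := by
        rw [Finset.sum_div]
        exact Finset.sum_congr rfl fun i _ => by ring
    _ ≤ 1 / 4 := by linarith

/-- Theorem 3.1: for the move-to-front scheme the biased coupon collector time `τ_u`
gives the mixing time up to a factor 25. -/
theorem mtf_mixing_time (n : ℕ) (p : Fin n → ℝ)
    (hpos : ∀ j, 0 < p j) (hsum : ∑ j, p j = 1)
    (hmono : ∀ i j : Fin n, i ≤ j → p j ≤ p i)
    (hthird : ∀ j, p j ≤ 1/3)
    (τu : ℕ)
    (hτu : τu = sInf {t : ℕ |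
      ∑ j ∈ Finset.univ.filter (fun j : Fin n => (j : ℕ) < n - 1), (1 - p j) ^ t ≤ 1/4})
    (π : Equiv.Perm (Fin n) → ℝ)
    (hπ0 : ∀ s, 0 ≤ π s) (hπ1 : ∑ s, π s = 1)
    (hstat : ∀ s', ∑ s, π s * mtfP n p s s' = π s') :
    (τu : ℝ) / 25 - 1 ≤ (mixTime (mtfP n p) π : ℝ) ∧ mixTime (mtfP n p) π ≤ τu := by
  set B := Finset.univ.filter (fun j : Fin n => (j : ℕ) < n - 1) with hBdef
  have hB : ∀ a c : Fin n, a ∉ B → c ∉ B → a = c := by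
    intro a c ha hc
    simp only [hBdef, Finset.mem_filter, Finset.mem_univ, true_and] at ha hc
    exact Fin.ext (by omega)
  have hne : {t : ℕ | ∑ j ∈ B, (1 - p j) ^ t ≤ 1 / 4}.Nonempty := by
    have hlim : Filter.Tendsto (fun t : ℕ => ∑ j ∈ B, (1 - p j) ^ t) Filter.atTop (nhds 0) := by
      rw [← Finset.sum_const_zero (s := B)]
      refine tendsto_finsetSum _ fun j _ => ?_
      exact tendsto_pow_atTop_nhds_zero_of_lt_one (by linarith [hthird j]) (by linarith [hpos j])
    exact (hlim.eventually_le_const (by norm_num)).exists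
  have hτ : ∑ j ∈ B, (1 - p j) ^ τu ≤ 1 / 4 := hτu ▸ Nat.sInf_mem hne
  have htv : ∀ s0, tvDist (evolve (mtfP n p) (dirac s0) τu) π ≤ 1 / 4 := fun s0 =>
    (tvDist_evolve_le (fun j => (hpos j).le) hsum hπ0 hπ1 hstat hB s0 τu).trans hτ
  refine ⟨?_, Finset.sup_le fun s0 _ => Nat.sInf_le (htv s0)⟩
  set t := sInf {t : ℕ | tvDist (evolve (mtfP n p) (dirac Fin.revPerm) t) π ≤ 1 / 4} with ht
  have ht_mem : tvDist (evolve (mtfP n p) (dirac Fin.revPerm) t) π ≤ 1 / 4 :=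
    Nat.sInf_mem (s := {t : ℕ | tvDist (evolve (mtfP n p) (dirac Fin.revPerm) t) π ≤ 1 / 4})
      ⟨τu, htv _⟩
  have htle : t ≤ mixTime (mtfP n p) π :=
    Finset.le_sup (f := fun s0 => sInf {t : ℕ | tvDist (evolve (mtfP n p) (dirac s0) t) π ≤ 1 / 4})
      (Finset.mem_univ Fin.revPerm)
  have hτle : τu ≤ 25 * (t + 1) := by
    rw [hτu]
    exact Nat.sInf_le (sum_pow_le_of_tvDist_le hpos hsum hmono hthird hπ0 hπ1 hstat ht_mem)
  have h1 : (τu : ℝ) ≤ 25 * (t + 1) := by exact_mod_cast hτle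
  have h2 : (t : ℝ) ≤ mixTime (mtfP n p) π := by exact_mod_cast htle
  linarith
end

section
/- Consider the move-to-front scheme on n cards with card probabilities p_1,…,p_n (each p_j > 0, ∑_j p_j = 1) and transition matrix P on the symmetric group S_n. For 1 ≤ j ≤ n−1, set γ_j := p_j + p_{j+1} and define Φ_j : S_n → ℝ by Φ_j(σ) = p_j/γ_j if card j+1 lies above card j in σ (i.e., the position of card j+1 is at most the position of card j), and Φ_j(σ) = −p_{j+1}/γ_j otherwise. Then Φ_j is a right eigenvector of P with eigenvalue 1 − γ_j; that is, ∑_{σ'} P(σ,σ') Φ_j(σ') = (1 − γ_j) Φ_j(σ) for every σ ∈ S_n. -/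
open Finset

/-- The test function `Φ_j` of Section 3.2: it takes the value `p_j/(p_j+p_{j+1})`
when card `j+1` lies above card `j` (its position is at most that of card `j`),
and `−p_{j+1}/(p_j+p_{j+1})` otherwise. -/
noncomputable def mtfPhi (n : ℕ) (p : Fin n → ℝ) (j : Fin n) (hj : (j : ℕ) + 1 < n)
    (σ : Equiv.Perm (Fin n)) : ℝ :=
  if σ ⟨(j : ℕ) + 1, hj⟩ ≤ σ j
    then p j / (p j + p ⟨(j : ℕ) + 1, hj⟩)
    else -(p ⟨(j : ℕ) + 1, hj⟩ / (p j + p ⟨(j : ℕ) + 1, hj⟩))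

/-- Rotating position `i` to the top preserves the relative order of the other positions. -/
lemma Fin.cycleRange_le_cycleRange_iff {m : ℕ} {i a b : Fin (m + 1)} (ha : a ≠ i) (hb : b ≠ i) :
    i.cycleRange a ≤ i.cycleRange b ↔ a ≤ b := by
  obtain ⟨a, rfl⟩ := Fin.exists_succAbove_eq ha
  obtain ⟨b, rfl⟩ := Fin.exists_succAbove_eq hb
  simp [Fin.cycleRange_succAbove, Fin.succAbove_le_succAbove_iff]

lemma sum_mtfP_mul_s7 (n : ℕ) (p : Fin n → ℝ) (f : Equiv.Perm (Fin n) → ℝ)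
    (σ : Equiv.Perm (Fin n)) :
    ∑ σ', mtfP n p σ σ' * f σ' = ∑ k, p k * f (Fin.cycleRange (σ k) * σ) := by
  simp only [mtfP, Finset.sum_mul, ite_mul, zero_mul]
  rw [Finset.sum_comm]
  simp

lemma mtfPhi_move_self {n : ℕ} (p : Fin n → ℝ) (j : Fin n) (hj : (j : ℕ) + 1 < n)
    (σ : Equiv.Perm (Fin n)) :
    mtfPhi n p j hj (Fin.cycleRange (σ j) * σ) =
      -(p ⟨(j : ℕ) + 1, hj⟩ / (p j + p ⟨(j : ℕ) + 1, hj⟩)) := by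
  obtain _ | m := n
  · exact j.elim0
  have hne : (⟨(j : ℕ) + 1, hj⟩ : Fin (m + 1)) ≠ j := by simp [Fin.ext_iff]
  refine if_neg ?_
  rw [Equiv.Perm.mul_apply, Equiv.Perm.mul_apply, Fin.cycleRange_self, Fin.le_zero_iff,
    ← Fin.cycleRange_self (σ j)]
  simpa only [EmbeddingLike.apply_eq_iff_eq] using hne

lemma mtfPhi_move_next {n : ℕ} (p : Fin n → ℝ) (j : Fin n) (hj : (j : ℕ) + 1 < n)
    (σ : Equiv.Perm (Fin n)) :
    mtfPhi n p j hj (Fin.cycleRange (σ ⟨(j : ℕ) + 1, hj⟩) * σ) =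
      p j / (p j + p ⟨(j : ℕ) + 1, hj⟩) := by
  obtain _ | m := n
  · exact j.elim0
  refine if_pos ?_
  rw [Equiv.Perm.mul_apply, Fin.cycleRange_self]
  exact Fin.zero_le _

lemma mtfPhi_move_of_ne {n : ℕ} (p : Fin n → ℝ) (j : Fin n) (hj : (j : ℕ) + 1 < n)
    (σ : Equiv.Perm (Fin n)) {k : Fin n} (hkj : k ≠ j) (hk : k ≠ ⟨(j : ℕ) + 1, hj⟩) :
    mtfPhi n p j hj (Fin.cycleRange (σ k) * σ) = mtfPhi n p j hj σ := by
  obtain _ | m := n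
  · exact j.elim0
  simp only [mtfPhi, Equiv.Perm.mul_apply,
    Fin.cycleRange_le_cycleRange_iff (σ.injective.ne hk.symm) (σ.injective.ne hkj.symm)]

/-- `Φ_j` is a right eigenvector of the move-to-front transition matrix with
eigenvalue `1 − γ_j` where `γ_j = p_j + p_{j+1}`. -/
theorem mtf_eigenvector (n : ℕ) (p : Fin n → ℝ)
    (hpos : ∀ j, 0 < p j) (hsum : ∑ j, p j = 1)
    (j : Fin n) (hj : (j : ℕ) + 1 < n) :
    ∀ σ : Equiv.Perm (Fin n),
      ∑ σ', mtfP n p σ σ' * mtfPhi n p j hj σ'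
        = (1 - (p j + p ⟨(j : ℕ) + 1, hj⟩)) * mtfPhi n p j hj σ := by
  intro σ
  have hne : j ≠ ⟨(j : ℕ) + 1, hj⟩ := by simp [Fin.ext_iff]
  have hmem : (⟨(j : ℕ) + 1, hj⟩ : Fin n) ∈ univ.erase j := by simpa using hne.symm
  rw [sum_mtfP_mul_s7, ← hsum, ← add_sum_erase univ _ (mem_univ j),
    ← add_sum_erase _ _ hmem, ← add_sum_erase univ p (mem_univ j),
    ← add_sum_erase _ p hmem, mtfPhi_move_self, mtfPhi_move_next,
    sum_congr rfl fun k hk => by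
      simp only [mem_erase, mem_univ, and_true] at hk
      rw [mtfPhi_move_of_ne p j hj σ hk.2 hk.1],
    ← sum_mul]
  ring
end

section
/- Fix integers n and k with 2 ≤ k ≤ n, and set p_j = 1/k for n−k+1 ≤ j ≤ n and p_j = 0 for 1 ≤ j ≤ n−k (the single-card chain of the bottom-to-top shuffle). Let λ ∈ ℂ with λ ∉ {0, 1/k, 2/k, …, (k−2)/k}. Then there exists a vector x ∈ ℂⁿ with x_1 = 1 satisfying λ x_j = p_j x_1 + (∑_{i<j} p_i) x_j + (∑_{i>j} p_i) x_{j+1} for 1 ≤ j ≤ n−1 and λ x_n = p_n x_1 + (∑_{i<n} p_i) x_n, if and only if λ^{n−k+1} − ((k−1)/k) λ^{n−k} − 1/k = 0; and in that case the solution is given by x_j = λ^{j−1} for 1 ≤ j ≤ n−k+1 and x_j = λ^{n−k} = 1/(kλ − (k−1)) for n−k+1 ≤ j ≤ n. -/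
open Finset

/-- Position probabilities (1-based) of the bottom-to-top shuffle: `p_j = 1/k` for
`n − k + 1 ≤ j ≤ n` and `p_j = 0` otherwise. -/
noncomputable def b2tp (n k : ℕ) (j : ℕ) : ℝ :=
  if n - k + 1 ≤ j ∧ j ≤ n then ((k : ℝ))⁻¹ else 0

/-- `m_j = ∑_{i<j} p_i` for the bottom-to-top single-card chain. -/
noncomputable def b2tm (n k : ℕ) (j : ℕ) : ℝ :=
  ∑ i ∈ Finset.Ico 1 j, b2tp n k i

/-- `M_j = ∑_{i>j} p_i` for the bottom-to-top single-card chain. -/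
noncomputable def b2tM (n k : ℕ) (j : ℕ) : ℝ :=
  ∑ i ∈ Finset.Ioc j n, b2tp n k i

/-- `(λ, x)` satisfies the eigenvalue equations of the single-card chain of the
bottom-to-top shuffle: `λ x_j = p_j x_1 + m_j x_j + M_j x_{j+1}` for `1 ≤ j ≤ n − 1`
and `λ x_n = p_n x_1 + m_n x_n`. -/
def b2tEigenEqns (n k : ℕ) (lam : ℂ) (x : ℕ → ℂ) : Prop :=
  (∀ j, 1 ≤ j → j ≤ n - 1 →
    lam * x j = (b2tp n k j : ℂ) * x 1 + (b2tm n k j : ℂ) * x j + (b2tM n k j : ℂ) * x (j + 1)) ∧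
  lam * x n = (b2tp n k n : ℂ) * x 1 + (b2tm n k n : ℂ) * x n

theorem b2tp_eq_zero {n k j : ℕ} (hj : j ≤ n - k) : b2tp n k j = 0 :=
  if_neg (by omega)

theorem b2tp_eq_inv {n k j : ℕ} (hj : n - k < j) (hjn : j ≤ n) : b2tp n k j = (k : ℝ)⁻¹ :=
  if_pos (by omega)

theorem b2tm_eq {n k j : ℕ} (hjn : j ≤ n) :
    b2tm n k j = ((j - (n - k + 1) : ℕ) : ℝ) * (k : ℝ)⁻¹ := by
  have h : (Finset.Ico 1 j).filter (fun i => n - k + 1 ≤ i ∧ i ≤ n) =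
      Finset.Ico (n - k + 1) j := by
    ext i
    simp only [Finset.mem_filter, Finset.mem_Ico]
    omega
  simp only [b2tm, b2tp]
  rw [← Finset.sum_filter, h, Finset.sum_const, Nat.card_Ico, nsmul_eq_mul]

theorem b2tM_eq (n k j : ℕ) :
    b2tM n k j = ((n - max j (n - k) : ℕ) : ℝ) * (k : ℝ)⁻¹ := by
  have h : (Finset.Ioc j n).filter (fun i => n - k + 1 ≤ i ∧ i ≤ n) =
      Finset.Ioc (max j (n - k)) n := by
    ext i
    simp only [Finset.mem_filter, Finset.mem_Ioc]
    omega
  simp only [b2tM, b2tp]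
  rw [← Finset.sum_filter, h, Finset.sum_const, Nat.card_Ioc, nsmul_eq_mul]

/-- The eigenvalue equations with explicit coefficients: a pure shift on the first `n - k`
positions, and linear coefficients on the last `k` positions. -/
theorem b2tEigenEqns_iff {n k : ℕ} (hk : 2 ≤ k) (hkn : k ≤ n) (lam : ℂ) (x : ℕ → ℂ) :
    b2tEigenEqns n k lam x ↔
      (∀ j, 1 ≤ j → j ≤ n - k → lam * x j = x (j + 1)) ∧
      (∀ t, t + 1 < k → (k * lam - t) * x (n - k + 1 + t) =
        x 1 + (k - 1 - t) * x (n - k + 1 + t + 1)) ∧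
      (k * lam - (k - 1)) * x n = x 1 := by
  have hk0 : (k : ℂ) ≠ 0 := by
    exact_mod_cast (by omega : k ≠ 0)
  have low (j : ℕ) (hj : j ≤ n - k) :
      (lam * x j = (b2tp n k j : ℂ) * x 1 + (b2tm n k j : ℂ) * x j
        + (b2tM n k j : ℂ) * x (j + 1)) ↔ lam * x j = x (j + 1) := by
    rw [b2tp_eq_zero hj, b2tm_eq (by omega : j ≤ n), b2tM_eq,
      show j - (n - k + 1) = 0 by omega, show n - max j (n - k) = k by omega]
    push_cast
    rw [mul_inv_cancel₀ hk0]
    simp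
  have high (t : ℕ) (ht : t + 1 < k) :
      (lam * x (n - k + 1 + t) = (b2tp n k (n - k + 1 + t) : ℂ) * x 1
        + (b2tm n k (n - k + 1 + t) : ℂ) * x (n - k + 1 + t)
        + (b2tM n k (n - k + 1 + t) : ℂ) * x (n - k + 1 + t + 1)) ↔
      (k * lam - t) * x (n - k + 1 + t) = x 1 + (k - 1 - t) * x (n - k + 1 + t + 1) := by
    rw [b2tp_eq_inv (by omega) (by omega), b2tm_eq (by omega), b2tM_eq,
      show n - k + 1 + t - (n - k + 1) = t by omega,
      show n - max (n - k + 1 + t) (n - k) = k - (1 + t) by omega]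
    push_cast [Nat.cast_sub (show 1 + t ≤ k by omega)]
    field_simp
    constructor <;> intro h <;> linear_combination h
  have last : (lam * x n = (b2tp n k n : ℂ) * x 1 + (b2tm n k n : ℂ) * x n) ↔
      (k * lam - (k - 1)) * x n = x 1 := by
    rw [b2tp_eq_inv (by omega) le_rfl, b2tm_eq le_rfl,
      show n - (n - k + 1) = k - 1 by omega]
    push_cast [Nat.cast_sub (show 1 ≤ k by omega)]
    field_simp
    constructor <;> intro h <;> linear_combination h
  unfold b2tEigenEqns
  rw [last, ← and_assoc]
  refine and_congr_left fun _ => ⟨fun h => ⟨fun j h1 hj => (low j hj).1 (h j h1 (by omega)),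
    fun t ht => (high t ht).1 (h _ (by omega) (by omega))⟩, fun h j h1 hj => ?_⟩
  by_cases hjk : j ≤ n - k
  · exact (low j hjk).2 (h.1 j h1 hjk)
  · obtain ⟨t, rfl⟩ := Nat.exists_eq_add_of_le (show n - k + 1 ≤ j by omega)
    exact (high t (by omega)).2 (h.2 t (by omega))

/-- On the last `k` positions a solution of the eigenvalue equations is constant. -/
theorem b2tEigenEqns.eq_last {n k : ℕ} (hk : 2 ≤ k) (hkn : k ≤ n) {lam : ℂ}
    (hlam : ∀ i : ℕ, i ≤ k - 2 → lam ≠ (i : ℂ) / (k : ℂ)) {x : ℕ → ℂ}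
    (h : b2tEigenEqns n k lam x) {j : ℕ} (hj : n - k + 1 ≤ j) (hjn : j ≤ n) : x j = x n := by
  obtain ⟨-, h2, h3⟩ := (b2tEigenEqns_iff hk hkn lam x).1 h
  have hk0 : (k : ℂ) ≠ 0 := by
    exact_mod_cast (by omega : k ≠ 0)
  induction hjn using Nat.decreasingInduction with
  | self => rfl
  | of_succ j hjn ih =>
    obtain ⟨t, rfl⟩ := Nat.exists_eq_add_of_le hj
    have e := h2 t (by omega)
    rw [ih (by omega)] at e
    have hne : (k : ℂ) * lam - t ≠ 0 := fun h0 =>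
      hlam t (by omega) (by rw [eq_div_iff hk0]; linear_combination h0)
    exact mul_left_cancel₀ hne (by linear_combination e - h3)

/-- On the first `n - k + 1` positions a solution of the eigenvalue equations is geometric. -/
theorem b2tEigenEqns.eq_pow {n k : ℕ} (hk : 2 ≤ k) (hkn : k ≤ n) {lam : ℂ} {x : ℕ → ℂ}
    (hx : x 1 = 1) (h : b2tEigenEqns n k lam x) {i : ℕ} (hi : i ≤ n - k) :
    x (i + 1) = lam ^ i := by
  obtain ⟨h1, -, -⟩ := (b2tEigenEqns_iff hk hkn lam x).1 h
  induction i with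
  | zero => simpa using hx
  | succ i ih => rw [← h1 (i + 1) (by omega) hi, ih (by omega), pow_succ']

theorem b2t_charpoly_iff {k : ℕ} (hk : 2 ≤ k) (a : ℕ) (lam : ℂ) :
    lam ^ (a + 1) - (((k : ℂ) - 1) / (k : ℂ)) * lam ^ a - 1 / (k : ℂ) = 0 ↔
      (k * lam - (k - 1)) * lam ^ a = 1 := by
  have hk0 : (k : ℂ) ≠ 0 := by
    exact_mod_cast (by omega : k ≠ 0)
  have e : (k : ℂ) * (lam ^ (a + 1) - (((k : ℂ) - 1) / (k : ℂ)) * lam ^ a - 1 / (k : ℂ)) =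
      (k * lam - (k - 1)) * lam ^ a - 1 := by
    field_simp
    ring
  rw [← sub_eq_zero (b := (1 : ℂ)), ← e, mul_eq_zero, or_iff_right hk0]

theorem b2tEigenEqns_of_charpoly {n k : ℕ} (hk : 2 ≤ k) (hkn : k ≤ n) {lam : ℂ}
    (h : (k * lam - (k - 1)) * lam ^ (n - k) = 1) :
    b2tEigenEqns n k lam
      (fun j : ℕ => if j ≤ n - k + 1 then lam ^ (j - 1) else lam ^ (n - k)) := by
  set x : ℕ → ℂ := fun j => if j ≤ n - k + 1 then lam ^ (j - 1) else lam ^ (n - k) with hx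
  have hlow (i : ℕ) (hi : i ≤ n - k) : x (i + 1) = lam ^ i := by
    simp [hx, hi]
  have hhigh (j : ℕ) (hj : n - k + 1 ≤ j) : x j = lam ^ (n - k) := by
    rcases hj.eq_or_lt with rfl | hj
    · exact hlow _ le_rfl
    · exact if_neg (by omega)
  have h1 : x 1 = 1 := by simpa using hlow 0 (by omega)
  refine (b2tEigenEqns_iff hk hkn lam x).2 ⟨fun j hj hjk => ?_, fun t _ => ?_, ?_⟩
  · obtain ⟨i, rfl⟩ := Nat.exists_eq_add_of_le' hj
    rw [hlow i (by omega), hlow (i + 1) hjk, pow_succ']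
  · rw [hhigh (n - k + 1 + t) (by omega), hhigh (n - k + 1 + t + 1) (by omega), h1]
    linear_combination h
  · rw [hhigh n (by omega), h1, h]

/-- Characterization of the eigenvalues of the single-card chain of the bottom-to-top
shuffle: for `λ ∉ {0, 1/k, …, (k−2)/k}`, an eigenvector normalized by `x_1 = 1` exists
iff `λ^{n−k+1} − ((k−1)/k) λ^{n−k} − 1/k = 0`, and in that case it is given by
`x_j = λ^{j−1}` for `j ≤ n−k+1` and `x_j = λ^{n−k} = 1/(kλ − (k−1))` for
`n−k+1 ≤ j ≤ n`. -/
theorem b2t_single_card_eigen (n k : ℕ) (hk : 2 ≤ k) (hkn : k ≤ n)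
    (lam : ℂ) (hlam : ∀ i : ℕ, i ≤ k - 2 → lam ≠ (i : ℂ) / (k : ℂ)) :
    ((∃ x : ℕ → ℂ, x 1 = 1 ∧ b2tEigenEqns n k lam x) ↔
      lam ^ (n - k + 1) - (((k : ℂ) - 1) / (k : ℂ)) * lam ^ (n - k) - 1 / (k : ℂ) = 0) ∧
    (lam ^ (n - k + 1) - (((k : ℂ) - 1) / (k : ℂ)) * lam ^ (n - k) - 1 / (k : ℂ) = 0 →
      ((fun j : ℕ => if j ≤ n - k + 1 then lam ^ (j - 1) else lam ^ (n - k)) 1 = 1 ∧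
       b2tEigenEqns n k lam
         (fun j : ℕ => if j ≤ n - k + 1 then lam ^ (j - 1) else lam ^ (n - k)) ∧
       lam ^ (n - k) = 1 / ((k : ℂ) * lam - ((k : ℂ) - 1)) ∧
       (∀ x : ℕ → ℂ, x 1 = 1 → b2tEigenEqns n k lam x →
         ∀ j, 1 ≤ j → j ≤ n →
           x j = if j ≤ n - k + 1 then lam ^ (j - 1) else lam ^ (n - k)))) := by
  have hchar := b2t_charpoly_iff hk (n - k) lam
  refine ⟨⟨?_, fun h => ⟨_, by simp, b2tEigenEqns_of_charpoly hk hkn (hchar.1 h)⟩⟩,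
    fun h => ⟨by simp, b2tEigenEqns_of_charpoly hk hkn (hchar.1 h),
      eq_one_div_of_mul_eq_one_right (hchar.1 h), fun x hx hE j h1 hjn => ?_⟩⟩
  · rintro ⟨x, hx, hE⟩
    rw [hchar, ← hE.eq_pow hk hkn hx le_rfl, hE.eq_last hk hkn hlam le_rfl (by omega)]
    exact ((b2tEigenEqns_iff hk hkn lam x).1 hE).2.2.trans hx
  · split_ifs with hj
    · obtain ⟨i, rfl⟩ := Nat.exists_eq_add_of_le' h1
      exact hE.eq_pow hk hkn hx (by omega)
    · rw [← hE.eq_pow hk hkn hx le_rfl, hE.eq_last hk hkn hlam (by omega) hjn,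
        hE.eq_last hk hkn hlam le_rfl (by omega)]
end

section
/- Fix integers n and k with 1 ≤ k < n, and set p_{n−k} = p_n = 1/2 and p_j = 0 for all other j (the single-card chain of the GR shuffle with p_{n−k} = p_n = 1/2). Let λ ∈ ℂ with λ ≠ 1/2 satisfy (2λ − 1)^k (2λ^{n−k} − 1) = 1. Define x ∈ ℂⁿ by x_j = λ^{j−1} for 1 ≤ j ≤ n−k and x_j = (2λ − 1)^{j−(n−k+1)} (2λ^{n−k} − 1) for n−k+1 ≤ j ≤ n. Then x (which has x_1 = 1) satisfies the eigenvalue equations of the single-card chain: λ x_j = x_{j+1} for 1 ≤ j ≤ n−k−1; λ x_{n−k} = (1/2) x_1 + (1/2) x_{n−k+1}; λ x_j = (1/2) x_j + (1/2) x_{j+1} for n−k+1 ≤ j ≤ n−1; and λ x_n = (1/2) x_1 + (1/2) x_n. -/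
/-- For the single-card chain of the GR shuffle with `p_{n−k} = p_n = 1/2`, if `λ ≠ 1/2`
satisfies the characteristic equation `(2λ − 1)^k (2λ^{n−k} − 1) = 1`, then the vector
`x` with `x_j = λ^{j−1}` for `1 ≤ j ≤ n−k` and
`x_j = (2λ − 1)^{j−(n−k+1)} (2λ^{n−k} − 1)` for `n−k+1 ≤ j ≤ n` (so `x_1 = 1`)
satisfies the eigenvalue equations of the chain. -/
theorem gr_single_card_eigenvector (n k : ℕ) (hk1 : 1 ≤ k) (hkn : k < n)
    (lam : ℂ) (hlam : lam ≠ 1/2)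
    (hchar : (2 * lam - 1) ^ k * (2 * lam ^ (n - k) - 1) = 1)
    (x : ℕ → ℂ)
    (hx : x = fun j : ℕ =>
      if j ≤ n - k then lam ^ (j - 1)
      else (2 * lam - 1) ^ (j - (n - k + 1)) * (2 * lam ^ (n - k) - 1)) :
    x 1 = 1 ∧
    (∀ j, 1 ≤ j → j ≤ n - k - 1 → lam * x j = x (j + 1)) ∧
    lam * x (n - k) = (1/2 : ℂ) * x 1 + (1/2 : ℂ) * x (n - k + 1) ∧
    (∀ j, n - k + 1 ≤ j → j ≤ n - 1 →
      lam * x j = (1/2 : ℂ) * x j + (1/2 : ℂ) * x (j + 1)) ∧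
    lam * x n = (1/2 : ℂ) * x 1 + (1/2 : ℂ) * x n := by
  obtain ⟨m, rfl⟩ : ∃ m, n = m + 1 + k := ⟨n - k - 1, by omega⟩
  obtain ⟨k, rfl⟩ : ∃ l, k = l + 1 := ⟨k - 1, by omega⟩
  rw [Nat.add_sub_cancel] at hx hchar ⊢
  have hlow : ∀ i ≤ m, x (i + 1) = lam ^ i := by
    intro i hi
    simp [hx, hi]
  have hhigh : ∀ i, x (m + 1 + 1 + i) = (2 * lam - 1) ^ i * (2 * lam ^ (m + 1) - 1) := by
    intro i
    have h : ¬ m + 1 + 1 + i ≤ m + 1 := by omega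
    simp only [hx, h, if_false, Nat.add_sub_cancel_left]
  have hone : x 1 = 1 := by simpa using hlow 0 (Nat.zero_le m)
  refine ⟨hone, ?_, ?_, ?_, ?_⟩
  · intro j hj hjm
    obtain ⟨i, rfl⟩ : ∃ i, j = i + 1 := ⟨j - 1, by omega⟩
    rw [hlow i (by omega), hlow (i + 1) (by omega)]
    ring
  · have h := hhigh 0
    rw [add_zero] at h
    rw [hlow m le_rfl, hone, h]
    ring
  · intro j hj _
    obtain ⟨i, rfl⟩ := Nat.exists_eq_add_of_le hj
    rw [add_assoc (m + 1 + 1) i 1, hhigh i, hhigh (i + 1)]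
    ring
  · rw [show m + 1 + (k + 1) = m + 1 + 1 + k by omega, hone, hhigh k]
    linear_combination (1 / 2 : ℂ) * hchar
end

section
/- For each n, consider the move-to-front scheme on n cards with card probabilities p_j = (1/j) / H_n, where H_n = ∑_{m=1}^n 1/m. Then the mixing time is Θ(n (log n)²): there exist constants c_1, c_2 > 0 and N such that for all n ≥ N, c_1 · n (log n)² ≤ τ_mix(n) ≤ c_2 · n (log n)². -/
open Finset

/-- Expectation of `F` over words of `t` independent letters with law `p`, latest letter first. -/
noncomputable def wordExp {α : Type*} [Fintype α] (p : α → ℝ) : ℕ → (List α → ℝ) → ℝ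
  | 0, F => F []
  | t + 1, F => ∑ j, p j * wordExp p t fun l => F (j :: l)

section WordExp

variable {α : Type*} [Fintype α] {p : α → ℝ}

theorem wordExp_add (t : ℕ) (F G : List α → ℝ) :
    wordExp p t (fun l => F l + G l) = wordExp p t F + wordExp p t G := by
  induction t generalizing F G with
  | zero => rfl
  | succ t ih => simp only [wordExp, ih, mul_add, sum_add_distrib]

theorem wordExp_const_mul (t : ℕ) (a : ℝ) (F : List α → ℝ) :
    wordExp p t (fun l => a * F l) = a * wordExp p t F := by
  induction t generalizing F with
  | zero => rfl
  | succ t ih =>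
    simp only [wordExp, ih, mul_sum]
    exact sum_congr rfl fun j _ => by ring

theorem wordExp_sub (t : ℕ) (F G : List α → ℝ) :
    wordExp p t (fun l => F l - G l) = wordExp p t F - wordExp p t G := by
  induction t generalizing F G with
  | zero => rfl
  | succ t ih => simp only [wordExp, ih, mul_sub, sum_sub_distrib]

theorem wordExp_sum {ι : Type*} (t : ℕ) (s : Finset ι) (F : ι → List α → ℝ) :
    wordExp p t (fun l => ∑ i ∈ s, F i l) = ∑ i ∈ s, wordExp p t (F i) := by
  induction t generalizing F with
  | zero => rfl
  | succ t ih =>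
    simp only [wordExp, ih, mul_sum]
    exact sum_comm

theorem wordExp_mono (hp : ∀ j, 0 ≤ p j) (t : ℕ) {F G : List α → ℝ} (h : ∀ l, F l ≤ G l) :
    wordExp p t F ≤ wordExp p t G := by
  induction t generalizing F G with
  | zero => exact h []
  | succ t ih =>
    exact sum_le_sum fun j _ => mul_le_mul_of_nonneg_left (ih fun l => h _) (hp j)

theorem abs_wordExp_le (hp : ∀ j, 0 ≤ p j) (t : ℕ) (F : List α → ℝ) :
    |wordExp p t F| ≤ wordExp p t fun l => |F l| := by
  have hneg : wordExp p t (fun l => -1 * F l) = -1 * wordExp p t F := wordExp_const_mul ..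
  refine abs_le'.2 ⟨wordExp_mono hp t fun l => le_abs_self _, ?_⟩
  calc -wordExp p t F = wordExp p t (fun l => -1 * F l) := by rw [hneg]; ring
    _ ≤ _ := wordExp_mono hp t fun l => by rw [neg_one_mul]; exact neg_le_abs _

theorem wordExp_const (hp1 : ∑ j, p j = 1) (t : ℕ) (a : ℝ) : wordExp p t (fun _ => a) = a := by
  induction t with
  | zero => rfl
  | succ t ih => simp only [wordExp, ih, ← sum_mul, hp1, one_mul]

theorem wordExp_forall_mem (t : ℕ) (Q : α → Prop) [DecidablePred Q] :
    wordExp p t (fun l => if ∀ c ∈ l, Q c then 1 else 0) =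
      (∑ c, if Q c then p c else 0) ^ t := by
  induction t with
  | zero => simp [wordExp]
  | succ t ih =>
    rw [wordExp, pow_succ', sum_mul]
    refine sum_congr rfl fun j _ => ?_
    by_cases hj : Q j
    · simp [hj, ih]
    · have := wordExp_const_mul (p := p) t 0 (fun _ => 0)
      simp only [mul_zero, zero_mul] at this
      simp [hj, this]

variable [DecidableEq α]

theorem wordExp_notMem (hp1 : ∑ j, p j = 1) (t : ℕ) (a : α) :
    wordExp p t (fun l => if a ∈ l then 0 else 1) = (1 - p a) ^ t := by
  have h : wordExp p t (fun l => if ∀ c ∈ l, c ≠ a then 1 else 0) =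
      (∑ c, if c ≠ a then p c else 0) ^ t := by
    convert wordExp_forall_mem (p := p) t (fun c => c ≠ a)
  have e : (fun l : List α => if a ∈ l then (0 : ℝ) else 1) =
      fun l => if ∀ c ∈ l, c ≠ a then 1 else 0 := by
    funext l
    by_cases ha : a ∈ l
    · rw [if_pos ha, if_neg fun h => h a ha rfl]
    · rw [if_neg ha, if_pos fun c hc (h : c = a) => ha (h ▸ hc)]
  rw [e, h, ← hp1]
  congr 1
  rw [eq_sub_iff_add_eq, ← sum_filter, filter_ne', sum_erase_add _ _ (mem_univ a)]

theorem wordExp_notMem_mul_notMem_le (hp : ∀ j, 0 ≤ p j) (hp1 : ∑ j, p j = 1) (t : ℕ) (a b : α) :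
    wordExp p t (fun l => (if a ∈ l then 0 else 1) * (if b ∈ l then 0 else 1)) ≤
      (1 - p a) ^ t * (1 - p b) ^ t + if a = b then (1 - p a) ^ t else 0 := by
  have hle : ∀ c, 0 ≤ 1 - p c := fun c => by
    rw [← hp1, sub_nonneg]; exact single_le_sum (fun j _ => hp j) (mem_univ c)
  by_cases hab : a = b
  · subst hab
    have e : (fun l : List α => (if a ∈ l then (0 : ℝ) else 1) * (if a ∈ l then 0 else 1)) =
        fun l => if a ∈ l then 0 else 1 := by
      funext l; split_ifs <;> simp
    rw [e, wordExp_notMem hp1, if_pos rfl]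
    have := pow_nonneg (hle a) t
    nlinarith
  · have h : wordExp p t (fun l => if ∀ c ∈ l, c ≠ a ∧ c ≠ b then 1 else 0) =
        (∑ c, if c ≠ a ∧ c ≠ b then p c else 0) ^ t := by
      convert wordExp_forall_mem (p := p) t (fun c => c ≠ a ∧ c ≠ b)
    have e : (fun l : List α => (if a ∈ l then (0 : ℝ) else 1) * (if b ∈ l then 0 else 1)) =
        fun l => if ∀ c ∈ l, c ≠ a ∧ c ≠ b then 1 else 0 := by
      funext l
      by_cases ha : a ∈ l
      · rw [if_pos ha, zero_mul, if_neg fun h => (h a ha).1 rfl]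
      · by_cases hb : b ∈ l
        · rw [if_pos hb, mul_zero, if_neg fun h => (h b hb).2 rfl]
        · rw [if_neg ha, if_neg hb, mul_one,
            if_pos fun c hc => ⟨fun h : c = a => ha (h ▸ hc), fun h : c = b => hb (h ▸ hc)⟩]
    have hs : (∑ c, if c ≠ a ∧ c ≠ b then p c else 0) = 1 - p a - p b := by
      rw [← hp1, ← sum_filter, filter_and, filter_ne', filter_ne',
        ← sum_erase_add _ _ (mem_univ a),
        ← sum_erase_add (univ.erase a) _ (mem_erase.2 ⟨Ne.symm hab, mem_univ b⟩)]
      have : univ.erase a ∩ univ.erase b = (univ.erase a).erase b := by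
        ext; simp [and_comm]
      rw [this]; ring
    have hs0 : 0 ≤ 1 - p a - p b := by
      rw [← hs]; exact sum_nonneg fun c _ => by split_ifs <;> simp [hp]
    rw [e, h, hs, if_neg hab, add_zero, ← mul_pow]
    exact pow_le_pow_left₀ hs0 (by nlinarith [hp a, hp b]) t

theorem wordExp_sq_sub_le (hp : ∀ j, 0 ≤ p j) (hp1 : ∑ j, p j = 1) (t : ℕ) (B : Finset α) :
    wordExp p t (fun l => ((∑ j ∈ B, if j ∈ l then (0 : ℝ) else 1) - ∑ j ∈ B, (1 - p j) ^ t) ^ 2)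
      ≤ ∑ j ∈ B, (1 - p j) ^ t := by
  set X := ∑ j ∈ B, (1 - p j) ^ t with hX
  have e : (fun l : List α => ((∑ j ∈ B, if j ∈ l then (0 : ℝ) else 1) - X) ^ 2) = fun l =>
      ((∑ i ∈ B, ∑ j ∈ B, (if i ∈ l then (0 : ℝ) else 1) * (if j ∈ l then 0 else 1)) -
        (2 * X) * ∑ j ∈ B, if j ∈ l then (0 : ℝ) else 1) + X ^ 2 := by
    funext l; rw [← sum_mul_sum]; ring
  rw [e, wordExp_add, wordExp_sub, wordExp_const hp1, wordExp_const_mul, wordExp_sum, wordExp_sum]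
  simp only [wordExp_sum, wordExp_notMem hp1]
  have h2 : ∑ i ∈ B, ∑ j ∈ B,
      wordExp p t (fun l => (if i ∈ l then 0 else 1) * (if j ∈ l then 0 else 1)) ≤ X * X + X := by
    calc _ ≤ ∑ i ∈ B, ∑ j ∈ B,
        ((1 - p i) ^ t * (1 - p j) ^ t + if i = j then (1 - p i) ^ t else 0) :=
          sum_le_sum fun i _ => sum_le_sum fun j _ => wordExp_notMem_mul_notMem_le hp hp1 t i j
      _ = X * X + X := by
        simp only [sum_add_distrib, ← sum_mul_sum, sum_ite_eq]
        congr 1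
        exact sum_congr rfl fun i hi => if_pos hi
  nlinarith

end WordExp

/-- The order of the deck after moving to the front the letters of a word, latest letter first. -/
def deck {n : ℕ} : List (Fin n) → Equiv.Perm (Fin n) → Equiv.Perm (Fin n)
  | [], s => s
  | j :: l, s => Fin.cycleRange (deck l s j) * deck l s

section Deck

variable {n : ℕ}

theorem evolve_mtfP_dirac (p : Fin n → ℝ) (s s' : Equiv.Perm (Fin n)) (t : ℕ) :
    evolve (mtfP n p) (dirac s) t s' = wordExp p t fun l => if deck l s = s' then 1 else 0 := by
  induction t generalizing s' with
  | zero => by_cases h : s = s' <;> simp [evolve, dirac, wordExp, deck, h, Ne.symm]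
  | succ t ih =>
    simp only [evolve, mtfP, wordExp, ih, mul_sum]
    rw [sum_comm]
    refine sum_congr rfl fun j _ => ?_
    rw [← wordExp_const_mul]
    have e : ∀ x : Equiv.Perm (Fin n), wordExp p t (fun l => if deck l s = x then 1 else 0) *
        (if Fin.cycleRange (x j) * x = s' then p j else 0) = wordExp p t (fun l =>
          (if Fin.cycleRange (x j) * x = s' then p j else 0) * if deck l s = x then 1 else 0) :=
      fun x => by rw [wordExp_const_mul, mul_comm]
    simp only [e]
    rw [← wordExp_sum]
    congr 1
    funext l
    simp only [mul_ite, mul_one, mul_zero, sum_ite_eq, mem_univ, if_true]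
    by_cases h : deck (j :: l) s = s'
    · rw [if_pos h, if_pos (show Fin.cycleRange (deck l s j) * deck l s = s' from h)]
    · rw [if_neg h, if_neg (show ¬ Fin.cycleRange (deck l s j) * deck l s = s' from h)]

theorem evolve_eq_sum_dirac {S : Type*} [Fintype S] [DecidableEq S] (P : S → S → ℝ) (μ : S → ℝ)
    (t : ℕ) (x : S) : evolve P μ t x = ∑ s, μ s * evolve P (dirac s) t x := by
  induction t generalizing x with
  | zero => simp [evolve, dirac]
  | succ t ih =>
    simp only [evolve, ih, sum_mul, mul_sum]
    rw [sum_comm]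
    exact sum_congr rfl fun _ _ => sum_congr rfl fun _ _ => by ring

theorem evolve_stationary {S : Type*} [Fintype S] {P : S → S → ℝ} {μ : S → ℝ}
    (h : ∀ x, ∑ s, μ s * P s x = μ x) (t : ℕ) : evolve P μ t = μ := by
  induction t with
  | zero => rfl
  | succ t ih => funext x; simp only [evolve, ih, h]

theorem cycleRange_self_lt {i k : Fin n} (h : k ≠ i) :
    Fin.cycleRange i i < Fin.cycleRange i k := by
  have : NeZero n := ⟨fun h0 => by subst h0; exact i.elim0⟩
  have h0 : Fin.cycleRange i i = 0 := Fin.cycleRange_self i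
  rw [h0, Fin.pos_iff_ne_zero, ← h0]
  exact (Fin.cycleRange i).injective.ne h

theorem cycleRange_lt_cycleRange {i a b : Fin n} (ha : a ≠ i) (hb : b ≠ i) :
    Fin.cycleRange i a < Fin.cycleRange i b ↔ a < b := by
  have key : ∀ {a : Fin n}, a ≠ i →
      ((Fin.cycleRange i a : Fin n) : ℕ) = if a < i then (a : ℕ) + 1 else a := by
    intro a ha
    split_ifs with h
    · exact Fin.coe_cycleRange_of_lt h
    · rw [Fin.cycleRange_of_gt (lt_of_le_of_ne (not_lt.1 h) (Ne.symm ha))]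
  have hka := key ha
  have hkb := key hb
  have ha' : (a : ℕ) ≠ i := fun h => ha (Fin.ext h)
  have hb' : (b : ℕ) ≠ i := fun h => hb (Fin.ext h)
  simp only [Fin.lt_def] at *
  split_ifs at hka hkb <;> omega

theorem deck_lt_of_mem_of_notMem {l : List (Fin n)} {a b : Fin n} (s : Equiv.Perm (Fin n))
    (ha : a ∈ l) (hb : b ∉ l) : deck l s a < deck l s b := by
  induction l with
  | nil => simp at ha
  | cons j l ih =>
    simp only [List.mem_cons, not_or] at ha hb
    simp only [deck, Equiv.Perm.mul_apply]
    by_cases haj : a = j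
    · subst haj
      exact cycleRange_self_lt ((deck l s).injective.ne hb.1)
    · exact (cycleRange_lt_cycleRange ((deck l s).injective.ne haj)
        ((deck l s).injective.ne hb.1)).2 (ih (ha.resolve_left haj) hb.2)

theorem deck_lt_deck_of_notMem {l : List (Fin n)} {a b : Fin n} (s : Equiv.Perm (Fin n))
    (ha : a ∉ l) (hb : b ∉ l) : deck l s a < deck l s b ↔ s a < s b := by
  induction l with
  | nil => rfl
  | cons j l ih =>
    simp only [List.mem_cons, not_or] at ha hb
    simp only [deck, Equiv.Perm.mul_apply]
    rw [cycleRange_lt_cycleRange ((deck l s).injective.ne ha.1) ((deck l s).injective.ne hb.1)]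
    exact ih ha.2 hb.2

theorem deck_lt_deck_congr {l : List (Fin n)} {a b : Fin n} (s s' : Equiv.Perm (Fin n))
    (ha : a ∈ l) (hb : b ∈ l) : deck l s a < deck l s b ↔ deck l s' a < deck l s' b := by
  induction l with
  | nil => simp at ha
  | cons j l ih =>
    simp only [List.mem_cons] at ha hb
    simp only [deck, Equiv.Perm.mul_apply]
    have inj := fun x : Equiv.Perm (Fin n) => (deck l x).injective
    by_cases haj : a = j <;> by_cases hbj : b = j
    · subst haj hbj; simp
    · subst haj
      exact iff_of_true (cycleRange_self_lt ((inj s).ne hbj)) (cycleRange_self_lt ((inj s').ne hbj))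
    · subst hbj
      exact iff_of_false (cycleRange_self_lt ((inj s).ne haj)).asymm
        (cycleRange_self_lt ((inj s').ne haj)).asymm
    · rw [cycleRange_lt_cycleRange ((inj s).ne haj) ((inj s).ne hbj),
        cycleRange_lt_cycleRange ((inj s').ne haj) ((inj s').ne hbj)]
      exact ih (ha.resolve_left haj) (hb.resolve_left hbj)

theorem deck_eq_of_forall_mem {l : List (Fin n)} (hl : ∀ c, c ∈ l) (s s' : Equiv.Perm (Fin n)) :
    deck l s = deck l s' := by
  have hmono : StrictMono ((deck l s).symm.trans (deck l s')) := by
    intro a b hab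
    rw [← (deck l s).apply_symm_apply a, ← (deck l s).apply_symm_apply b,
      deck_lt_deck_congr s s' (hl _) (hl _)] at hab
    exact hab
  have e := Subsingleton.elim (hmono.orderIsoOfSurjective _ (Equiv.surjective _))
    (OrderIso.refl (Fin n))
  ext1 a
  have h := DFunLike.congr_fun e (deck l s a)
  simpa using h.symm

end Deck

section Mixing

variable {n : ℕ} {p : Fin n → ℝ} {π : Equiv.Perm (Fin n) → ℝ}

theorem tvDist_evolve_mtfP_le (hp : ∀ j, 0 ≤ p j) (hp1 : ∑ j, p j = 1) (hπ : ∀ s, 0 ≤ π s)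
    (hπ1 : ∑ s, π s = 1) (hst : ∀ x, ∑ s, π s * mtfP n p s x = π x) (s : Equiv.Perm (Fin n))
    (t : ℕ) : tvDist (evolve (mtfP n p) (dirac s) t) π ≤ ∑ j, (1 - p j) ^ t := by
  set F : Equiv.Perm (Fin n) → Equiv.Perm (Fin n) → List (Fin n) → ℝ :=
    fun x y l => if deck l x = y then 1 else 0 with hF
  have hdiff : ∀ x, evolve (mtfP n p) (dirac s) t x - π x =
      ∑ s', π s' * wordExp p t (fun l => F s x l - F s' x l) := by
    intro x
    have hx : π x = ∑ s', π s' * evolve (mtfP n p) (dirac s') t x := by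
      rw [← evolve_eq_sum_dirac, evolve_stationary hst]
    rw [hx]
    simp only [wordExp_sub, mul_sub, sum_sub_distrib, evolve_mtfP_dirac, ← sum_mul, hπ1, one_mul, hF]
  have hcard : ∀ s' l, ∑ x, |F s x l - F s' x l| ≤ 2 * ∑ j, if j ∈ l then (0 : ℝ) else 1 := by
    intro s' l
    by_cases hl : ∀ c, c ∈ l
    · simp [hF, deck_eq_of_forall_mem hl s s', hl]
    · push Not at hl
      obtain ⟨c, hc⟩ := hl
      have h1 : (1 : ℝ) ≤ ∑ j, if j ∈ l then (0 : ℝ) else 1 := by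
        calc (1 : ℝ) = if c ∈ l then (0 : ℝ) else 1 := by rw [if_neg hc]
          _ ≤ _ := single_le_sum (f := fun j => if j ∈ l then (0 : ℝ) else 1)
            (fun j _ => by split_ifs <;> simp) (mem_univ c)
      calc _ ≤ ∑ x, (F s x l + F s' x l) := sum_le_sum fun x _ => by
            simp only [hF]; split_ifs <;> norm_num
        _ = 2 := by simp only [hF, sum_add_distrib, sum_ite_eq, mem_univ, if_true]; norm_num
        _ ≤ _ := by linarith
  calc tvDist (evolve (mtfP n p) (dirac s) t) π
      = 1 / 2 * ∑ x, |∑ s', π s' * wordExp p t (fun l => F s x l - F s' x l)| := by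
        simp only [tvDist, hdiff]
    _ ≤ 1 / 2 * ∑ x, ∑ s', π s' * wordExp p t (fun l => |F s x l - F s' x l|) := by
        gcongr with x
        refine (abs_sum_le_sum_abs _ _).trans (sum_le_sum fun s' _ => ?_)
        rw [abs_mul, abs_of_nonneg (hπ s')]
        exact mul_le_mul_of_nonneg_left (abs_wordExp_le hp t _) (hπ s')
    _ = 1 / 2 * ∑ s', π s' * wordExp p t (fun l => ∑ x, |F s x l - F s' x l|) := by
        rw [sum_comm]; simp only [wordExp_sum, mul_sum]
    _ ≤ 1 / 2 * ∑ s', π s' *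
          wordExp p t (fun l => 2 * ∑ j, if j ∈ l then (0 : ℝ) else 1) := by
        gcongr with s' _
        · exact hπ s'
        · exact wordExp_mono hp t (hcard s')
    _ = ∑ j, (1 - p j) ^ t := by
        rw [← sum_mul, hπ1, wordExp_const_mul, wordExp_sum]
        simp only [wordExp_notMem hp1]; ring

theorem sum_filter_sub_le_tvDist {S : Type*} [Fintype S] {μ ν : S → ℝ}
    (h : ∑ s, μ s = ∑ s, ν s) (A : S → Prop) [DecidablePred A] :
    (∑ s, if A s then μ s else 0) - (∑ s, if A s then ν s else 0) ≤ tvDist μ ν := by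
  have h' : ∑ s, 1 / 2 * (μ s - ν s) = 0 := by rw [← mul_sum, sum_sub_distrib, h, sub_self, mul_zero]
  rw [tvDist, mul_sum, ← sum_sub_distrib, ← sub_zero (∑ s, _ : ℝ), ← h', ← sum_sub_distrib]
  refine sum_le_sum fun s _ => ?_
  have := le_abs_self (μ s - ν s)
  have := neg_le_abs (μ s - ν s)
  split_ifs <;> linarith

/-- In the deck `σ`, the two cards at the bottom are in the order they have in `s`. -/
def BottomAgree (hn : 2 ≤ n) (s σ : Equiv.Perm (Fin n)) : Prop :=
  s (σ.symm ⟨n - 2, by omega⟩) < s (σ.symm ⟨n - 1, by omega⟩)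

theorem bottomAgree_deck (hn : 2 ≤ n) (s : Equiv.Perm (Fin n)) {l : List (Fin n)} {x y : Fin n}
    (hxy : x ≠ y) (hx : x ∉ l) (hy : y ∉ l) : BottomAgree hn s (deck l s) := by
  have hxy' : (deck l s x : ℕ) ≠ deck l s y := fun h => hxy ((deck l s).injective (Fin.ext h))
  have key : ∀ i : Fin n, n - 2 ≤ (i : ℕ) → (deck l s).symm i ∉ l := by
    intro i hi hmem
    have h1 := deck_lt_of_mem_of_notMem s hmem hx
    have h2 := deck_lt_of_mem_of_notMem s hmem hy
    rw [Equiv.apply_symm_apply, Fin.lt_def] at h1 h2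
    have := (deck l s x).2
    have := (deck l s y).2
    omega
  rw [BottomAgree, ← deck_lt_deck_of_notMem s (key _ (by simp)) (key _ (by simp; omega))]
  simp only [Equiv.apply_symm_apply, Fin.lt_def]
  omega

open Classical in
theorem exists_bottomAgree_le (hn : 2 ≤ n) (hπ : ∀ s, 0 ≤ π s) (hπ1 : ∑ s, π s = 1) :
    ∃ s, (∑ σ, if BottomAgree hn s σ then π σ else 0) ≤ 1 / 2 := by
  by_contra! h
  have h1 := h 1
  have h2 := h Fin.revPerm
  have : (∑ σ, if BottomAgree hn 1 σ then π σ else 0) +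
      (∑ σ, if BottomAgree hn Fin.revPerm σ then π σ else 0) ≤ 1 := by
    rw [← hπ1, ← sum_add_distrib]
    refine sum_le_sum fun σ _ => ?_
    have hor : ¬ (BottomAgree hn 1 σ ∧ BottomAgree hn Fin.revPerm σ) := by
      rintro ⟨ha, hb⟩
      simp only [BottomAgree, Fin.revPerm_apply, Fin.rev_lt_rev, Equiv.Perm.one_apply] at ha hb
      exact ha.asymm hb
    have := hπ σ
    split_ifs with ha hb
    · exact absurd ⟨ha, hb⟩ hor
    all_goals linarith
  linarith

open Classical in
theorem lt_tvDist_evolve_mtfP (hn : 2 ≤ n) (hp : ∀ j, 0 ≤ p j) (hp1 : ∑ j, p j = 1)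
    (hπ1 : ∑ s, π s = 1) {s : Equiv.Perm (Fin n)}
    (hs : (∑ σ, if BottomAgree hn s σ then π σ else 0) ≤ 1 / 2) {t : ℕ} (B : Finset (Fin n))
    (hB : 8 ≤ ∑ j ∈ B, (1 - p j) ^ t) : 1 / 4 < tvDist (evolve (mtfP n p) (dirac s) t) π := by
  have hsum : ∀ A : Equiv.Perm (Fin n) → Prop,
      (∑ σ, if A σ then evolve (mtfP n p) (dirac s) t σ else 0) =
        wordExp p t fun l => if A (deck l s) then 1 else 0 := by
    intro A
    have e : (fun l => if A (deck l s) then (1 : ℝ) else 0) =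
        fun l => ∑ σ, (if A σ then (1 : ℝ) else 0) * if deck l s = σ then 1 else 0 := by
      funext l; simp
    rw [e, wordExp_sum]
    refine sum_congr rfl fun σ _ => ?_
    rw [wordExp_const_mul, evolve_mtfP_dirac, ite_mul, one_mul, zero_mul]
  have hmass : ∑ σ, evolve (mtfP n p) (dirac s) t σ = ∑ σ, π σ := by
    have := hsum fun _ => True
    simp only [if_true, wordExp_const hp1] at this
    rw [this, hπ1]
  have htv := sum_filter_sub_le_tvDist hmass (BottomAgree hn s)
  rw [hsum] at htv
  have hvar := wordExp_sq_sub_le hp hp1 t B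
  set X := ∑ j ∈ B, (1 - p j) ^ t
  have hX : (0 : ℝ) < (X - 1) ^ 2 := by nlinarith
  have hlow : wordExp p t (fun l => 1 - ((X - 1) ^ 2)⁻¹ *
      ((∑ j ∈ B, if j ∈ l then (0 : ℝ) else 1) - X) ^ 2) ≤
        wordExp p t fun l => if BottomAgree hn s (deck l s) then 1 else 0 := by
    refine wordExp_mono hp t fun l => ?_
    by_cases hA : BottomAgree hn s (deck l s)
    · rw [if_pos hA]
      have : 0 ≤ ((X - 1) ^ 2)⁻¹ * ((∑ j ∈ B, if j ∈ l then (0 : ℝ) else 1) - X) ^ 2 := by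
        positivity
      linarith
    · rw [if_neg hA, sub_nonpos, inv_mul_eq_div, one_le_div hX]
      have hc : (#{j ∈ B | j ∉ l} : ℝ) ≤ 1 := by
        rw [← Nat.cast_one, Nat.cast_le, card_le_one]
        intro x hx y hy
        by_contra hxy
        exact hA (bottomAgree_deck hn s hxy (mem_filter.1 hx).2 (mem_filter.1 hy).2)
      have e : (∑ j ∈ B, if j ∈ l then (0 : ℝ) else 1) = #{j ∈ B | j ∉ l} := by
        rw [card_filter]; push_cast
        exact sum_congr rfl fun j _ => by split_ifs <;> simp_all
      rw [e]
      nlinarith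
  rw [wordExp_sub, wordExp_const hp1, wordExp_const_mul] at hlow
  have h49 : ((X - 1) ^ 2)⁻¹ * X < 1 / 4 := by
    rw [inv_mul_eq_div, div_lt_iff₀ hX]; nlinarith
  have : ((X - 1) ^ 2)⁻¹ * wordExp p t (fun l =>
      ((∑ j ∈ B, if j ∈ l then (0 : ℝ) else 1) - X) ^ 2) ≤ ((X - 1) ^ 2)⁻¹ * X :=
    mul_le_mul_of_nonneg_left hvar (by positivity)
  linarith

end Mixing

theorem mixTime_le {S : Type*} [Fintype S] [DecidableEq S] {P : S → S → ℝ} {π : S → ℝ} {t : ℕ}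
    (h : ∀ s, tvDist (evolve P (dirac s) t) π ≤ 1 / 4) : mixTime P π ≤ t :=
  Finset.sup_le fun s _ => Nat.sInf_le (h s)

theorem le_mixTime {S : Type*} [Fintype S] [DecidableEq S] {P : S → S → ℝ} {π : S → ℝ} {s : S}
    {t : ℕ} {T : ℝ} (ht : tvDist (evolve P (dirac s) t) π ≤ 1 / 4)
    (h : ∀ t : ℕ, (t : ℝ) ≤ T → 1 / 4 < tvDist (evolve P (dirac s) t) π) :
    T ≤ mixTime P π := by
  have hmem := Nat.sInf_mem (s := {t : ℕ | tvDist (evolve P (dirac s) t) π ≤ 1 / 4}) ⟨t, ht⟩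
  have hle : sInf {t : ℕ | tvDist (evolve P (dirac s) t) π ≤ 1 / 4} ≤ mixTime P π :=
    Finset.le_sup (f := fun s => sInf {t : ℕ | tvDist (evolve P (dirac s) t) π ≤ 1 / 4})
      (mem_univ s)
  by_contra! hlt
  exact absurd hmem (not_le.2 (h _ (le_trans (Nat.cast_le.2 hle) hlt.le)))

section Harmonic

theorem log_le_sum_Icc (n : ℕ) (hn : 0 < n) : Real.log n ≤ ∑ m ∈ Finset.Icc 1 n, (1 : ℝ) / m := by
  have h := log_add_one_le_harmonic n
  rw [harmonic_eq_sum_Icc] at h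
  push_cast at h
  simp only [one_div]
  refine le_trans (Real.log_le_log (by exact_mod_cast hn) ?_) h
  linarith

theorem sum_Icc_le_one_add_log (n : ℕ) :
    ∑ m ∈ Finset.Icc 1 n, (1 : ℝ) / m ≤ 1 + Real.log n := by
  have h := harmonic_le_one_add_log n
  rw [harmonic_eq_sum_Icc] at h
  push_cast at h
  simpa only [one_div] using h

theorem sum_harmonic_weights {n : ℕ} (hn : 0 < n) :
    ∑ j : Fin n, (1 / ((j : ℝ) + 1)) / (∑ m ∈ Finset.Icc 1 n, (1 : ℝ) / m) = 1 := by
  have hpos : 0 < ∑ m ∈ Finset.Icc 1 n, (1 : ℝ) / m :=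
    sum_pos (fun m hm => by have := (mem_Icc.1 hm).1; positivity) ⟨1, by simp; omega⟩
  rw [← sum_div, div_eq_one_iff_eq hpos.ne',
    Fin.sum_univ_eq_sum_range (fun j : ℕ => 1 / ((j : ℝ) + 1)), range_eq_Ico]
  have h := sum_Ico_add' (fun m : ℕ => 1 / (m : ℝ)) 0 n 1
  push_cast at h
  rw [h]
  rfl

theorem sum_one_sub_pow_le {n t : ℕ} {p : Fin n → ℝ} {q : ℝ} (hn : 0 < n) (h1 : ∀ j, p j ≤ 1)
    (hq : ∀ j, q ≤ p j) (ht : Real.log (4 * n) ≤ q * t) : ∑ j, (1 - p j) ^ t ≤ 1 / 4 := by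
  have hn' : (0 : ℝ) < n := by exact_mod_cast hn
  have h : ∀ j, (1 - p j) ^ t ≤ (4 * (n : ℝ))⁻¹ := by
    intro j
    calc (1 - p j) ^ t ≤ Real.exp (-q) ^ t := by
          refine pow_le_pow_left₀ (sub_nonneg.2 (h1 j)) ?_ t
          linarith [Real.add_one_le_exp (-q), hq j]
      _ = Real.exp (-(q * t)) := by rw [← Real.exp_nat_mul]; ring_nf
      _ ≤ Real.exp (-Real.log (4 * n)) := by gcongr
      _ = _ := by rw [Real.exp_neg, Real.exp_log (by positivity)]
  calc _ ≤ ∑ _j : Fin n, (4 * (n : ℝ))⁻¹ := sum_le_sum fun j _ => h j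
    _ = 1 / 4 := by rw [sum_const, card_univ, Fintype.card_fin, nsmul_eq_mul]; field_simp

theorem exp_le_one_sub_pow {q x : ℝ} (t : ℕ) (hq0 : 0 ≤ q) (hq : q ≤ 1 / 2) (hx : x ≤ q) :
    Real.exp (-(2 * q * t)) ≤ (1 - x) ^ t := by
  have h : Real.exp (-(2 * q)) ≤ 1 - q := by
    have h1 := Real.add_one_le_exp (2 * q)
    rw [Real.exp_neg, inv_le_iff_one_le_mul₀ (Real.exp_pos _)]
    nlinarith
  calc Real.exp (-(2 * q * t)) = Real.exp (-(2 * q)) ^ t := by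
        rw [← Real.exp_nat_mul]; ring_nf
    _ ≤ _ := pow_le_pow_left₀ (Real.exp_pos _).le (by linarith) t

theorem le_sum_one_sub_pow {n t : ℕ} {p : Fin n → ℝ} {q : ℝ} (hn : 576 ≤ n) (hq0 : 0 ≤ q)
    (hq : q ≤ 1 / 2) (hpq : ∀ j : Fin n, n ≤ 2 * (j : ℕ) → p j ≤ q)
    (ht : 2 * q * t ≤ Real.log n / 2) :
    8 ≤ ∑ j ∈ univ.filter fun j : Fin n => n ≤ 2 * (j : ℕ), (1 - p j) ^ t := by
  have hn0 : (576 : ℝ) ≤ n := by exact_mod_cast hn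
  have hsqrt : 24 ≤ √(n : ℝ) := Real.le_sqrt_of_sq_le (by nlinarith)
  have hsq : √(n : ℝ) * √(n : ℝ) = n := Real.mul_self_sqrt (by linarith)
  have hcard : (n : ℝ) / 3 ≤ #{j : Fin n | n ≤ 2 * (j : ℕ)} := by
    have h : n / 2 ≤ #{j : Fin n | n ≤ 2 * (j : ℕ)} := by
      calc n / 2 = #(univ : Finset (Fin (n / 2))) := by simp
        _ ≤ _ := card_le_card_of_injOn (fun i : Fin (n / 2) => (⟨n - 1 - i, by omega⟩ : Fin n))
          (fun i _ => by simp; omega)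
          (fun i _ k _ h => by simp only [Fin.mk.injEq] at h; ext; omega)
    have h3 : n ≤ 3 * (n / 2) := by omega
    have h3' : (n : ℝ) ≤ 3 * ((n / 2 : ℕ) : ℝ) := by exact_mod_cast h3
    have h' : ((n / 2 : ℕ) : ℝ) ≤ #{j : Fin n | n ≤ 2 * (j : ℕ)} := by exact_mod_cast h
    linarith
  have hterm : ∀ j : Fin n, n ≤ 2 * (j : ℕ) → (√(n : ℝ))⁻¹ ≤ (1 - p j) ^ t := by
    intro j hj
    refine le_trans ?_ (exp_le_one_sub_pow t hq0 hq (hpq j hj))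
    rw [← Real.exp_log (show 0 < (√(n : ℝ))⁻¹ by positivity), Real.log_inv,
      Real.log_sqrt (by positivity)]
    gcongr
  calc (8 : ℝ) ≤ √(n : ℝ) / 3 := by linarith
    _ = n / 3 * (√(n : ℝ))⁻¹ := by
      rw [eq_mul_inv_iff_mul_eq₀ (by positivity)]; linarith
    _ ≤ #{j : Fin n | n ≤ 2 * (j : ℕ)} * (√(n : ℝ))⁻¹ := by gcongr
    _ = ∑ j ∈ univ.filter fun j : Fin n => n ≤ 2 * (j : ℕ), (√(n : ℝ))⁻¹ := by rw [sum_const, nsmul_eq_mul]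
    _ ≤ _ := sum_le_sum fun j hj => hterm j (mem_filter.1 hj).2

end Harmonic

/-- Example (c): the move-to-front scheme with `p_j ∝ 1/j` has mixing time
`Θ(n (log n)²)` (for any stationary distribution `π`, which is unique). -/
theorem mtf_harmonic_mixing :
    ∃ c₁ > (0 : ℝ), ∃ c₂ > (0 : ℝ), ∃ N : ℕ, ∀ n ≥ N,
      ∀ π : Equiv.Perm (Fin n) → ℝ,
        (∀ s, 0 ≤ π s) → (∑ s, π s = 1) →
        (∀ s', ∑ s, π s *
          mtfP n (fun j => (1 / ((j : ℝ) + 1)) / (∑ m ∈ Finset.Icc 1 n, (1 : ℝ) / m)) s s'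
            = π s') →
        c₁ * n * Real.log n ^ 2
            ≤ (mixTime
                (mtfP n (fun j => (1 / ((j : ℝ) + 1)) / (∑ m ∈ Finset.Icc 1 n, (1 : ℝ) / m)))
                π : ℝ) ∧
        (mixTime
            (mtfP n (fun j => (1 / ((j : ℝ) + 1)) / (∑ m ∈ Finset.Icc 1 n, (1 : ℝ) / m)))
            π : ℝ)
          ≤ c₂ * n * Real.log n ^ 2 := by
  refine ⟨1 / 8, by norm_num, 7, by norm_num, 576, fun n hn π hπ hπ1 hst => ?_⟩
  have hn0 : (576 : ℝ) ≤ n := by exact_mod_cast hn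
  have hp1 := sum_harmonic_weights (n := n) (by omega)
  have hHlow := log_le_sum_Icc n (by omega)
  have hHup := sum_Icc_le_one_add_log n
  set H := ∑ m ∈ Finset.Icc 1 n, (1 : ℝ) / m
  set p : Fin n → ℝ := fun j => (1 / ((j : ℝ) + 1)) / H with hpdef
  have hlog4 : Real.log 4 ≤ Real.log n := Real.log_le_log (by norm_num) (by linarith)
  have hlog1 : 1 ≤ Real.log n := by
    rw [Real.le_log_iff_exp_le (by linarith)]
    linarith [Real.exp_one_lt_d9]
  have hH : 1 ≤ H := hlog1.trans hHlow
  have hp : ∀ j, 0 ≤ p j := fun j => by positivity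
  have hple : ∀ j, p j ≤ 1 := fun j => by
    rw [← hp1]; exact single_le_sum (fun j _ => hp j) (mem_univ j)
  have hnH : 0 < (n : ℝ) * H := by positivity
  set t₀ := ⌈n * H * Real.log (4 * n)⌉₊
  have hlog4n : Real.log (4 * n) ≤ 2 * Real.log n := by
    rw [Real.log_mul (by norm_num) (by positivity)]; linarith
  have hlog4n0 : 0 ≤ Real.log (4 * n) := Real.log_nonneg (by linarith)
  have hmix : ∀ s, tvDist (evolve (mtfP n p) (dirac s) t₀) π ≤ 1 / 4 := fun s => by
    refine (tvDist_evolve_mtfP_le hp hp1 hπ hπ1 hst s t₀).trans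
      (sum_one_sub_pow_le (q := 1 / (n * H)) (by omega) hple (fun j => ?_) ?_)
    · have hj : (j : ℝ) + 1 ≤ n := by exact_mod_cast j.2
      simp only [hpdef, div_div]
      gcongr
    · rw [one_div, inv_mul_eq_div, le_div_iff₀ hnH, mul_comm]
      exact Nat.le_ceil _
  constructor
  · obtain ⟨s, hs⟩ := exists_bottomAgree_le (by omega : 2 ≤ n) hπ hπ1
    calc 1 / 8 * n * Real.log n ^ 2 = n * Real.log n * Real.log n / 8 := by ring
      _ ≤ n * H * Real.log n / 8 := by gcongr
      _ ≤ _ := le_mixTime (hmix s) fun t ht => ?_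
    refine lt_tvDist_evolve_mtfP (by omega) hp hp1 hπ1 hs _
      (le_sum_one_sub_pow (q := 2 / (n * H)) hn (by positivity) ?_ (fun j hj => ?_) ?_)
    · rw [div_le_iff₀ hnH]; nlinarith
    · have hj' : (n : ℝ) ≤ 2 * (j : ℝ) := by exact_mod_cast hj
      simp only [hpdef, div_div]
      rw [div_le_div_iff₀ (by positivity) hnH]
      nlinarith
    · calc 2 * (2 / (n * H)) * t ≤ 2 * (2 / (n * H)) * (n * H * Real.log n / 8) := by gcongr
        _ = Real.log n / 2 := by field_simp; norm_num
  · calc (mixTime (mtfP n p) π : ℝ) ≤ t₀ := Nat.cast_le.2 (mixTime_le hmix)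
      _ ≤ n * H * Real.log (4 * n) + 1 := (Nat.ceil_lt_add_one (by positivity)).le
      _ ≤ n * (2 * Real.log n) * (2 * Real.log n) + n * Real.log n ^ 2 := by
        gcongr
        · linarith
        · nlinarith
      _ ≤ 7 * n * Real.log n ^ 2 := by nlinarith [mul_nonneg (by linarith : (0 : ℝ) ≤ n) (sq_nonneg (Real.log n))]
end
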